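/- arXiv:1211.2059 — 15 statements merged into one kernel-verified Lean document; each statement's English description precedes it below -/
import Mathlib

section
/- Let p be a prime number not belonging to {2, 3, 7, 11, 131, 193, 599, 3541, 8009}, let e be a natural number, and let K be a field of characteristic 0. If P ∈ K[X] is a polynomial of degree n = 5·p^e such that for every integer i with 1 ≤ i ≤ n−1 the polynomials P and its i-th Hasse derivative are not coprime, then there exist c, r ∈ K such that P = c·(X − r)^n. -/
open Polynomial

/-- a field in which the relevant primes are nonzero -/
structure GoodField (k : Type*) [Field k] : Prop where
  h2 : (2 : k) ≠ 0
  h3 : (3 : k) ≠ 0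
  h5 : (5 : k) ≠ 0
  h7 : (7 : k) ≠ 0
  h11 : (11 : k) ≠ 0
  h131 : (131 : k) ≠ 0
  h193 : (193 : k) ≠ 0
  h599 : (599 : k) ≠ 0
  h3541 : (3541 : k) ≠ 0
  h8009 : (8009 : k) ≠ 0

lemma core_uv {k : Type*} [Field k] (H : GoodField k) {c v w : k}
    (hv0 : c = 30 * v - 10 * v ^ 3)
    (hv : v = 0 ∨ v = 1 ∨ 9 * v ^ 3 - v ^ 2 - 21 * v + 9 = 0)
    (hw : w * (w ^ 4 - 10 * w ^ 2 + c * w + (9 - c)) = 0)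
    (hw0 : 5 * w ^ 4 - 30 * w ^ 2 + 2 * c * w + (9 - c) = 0) : False := by
  obtain ⟨h2, h3, h5, h7, h11, h131, h193, h599, h3541, h8009⟩ := H
  have key : c = 9 ∨ c = 16 ∨ 27 * (c - 8) ^ 2 + 112 * (c - 8) - 3136 = 0 := by
    by_cases w0 : w = 0
    · left; subst w0; linear_combination -hw0
    by_cases w1 : w = 1
    · right; left; subst w1; linear_combination hw0
    right; right
    have e1 : w ^ 3 + w ^ 2 - 9 * w - 9 + c = 0 := by
      apply mul_left_cancel₀ (mul_ne_zero w0 (sub_ne_zero.2 w1))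
      linear_combination hw
    have e2 : 3 * w ^ 2 + 2 * w - 9 = 0 := by
      apply mul_left_cancel₀ (mul_ne_zero w0 (sub_ne_zero.2 w1))
      linear_combination hw0 - (2 * w - 1) * e1
    have e3 : 9 * (c - 8) - 56 * w = 0 := by
      linear_combination 9 * e1 - (3 * w + 1) * e2
    have h9 : (3 : k) ^ 3 ≠ 0 := pow_ne_zero _ h3
    have h9' : (9 : k) ≠ 0 := by
      have : (3 : k) ^ 2 ≠ 0 := pow_ne_zero _ h3
      norm_num at this; exact this
    apply mul_left_cancel₀ h9'
    linear_combination (27 * (c - 8) + 3 * 56 * w + 112) * e3 + 3136 * e2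
  rcases hv with rfl | rfl | hF
  · obtain rfl : c = 0 := by linear_combination hv0
    rcases key with h | h | h
    · exact pow_ne_zero 2 h3 (by linear_combination -h)
    · exact pow_ne_zero 4 h2 (by linear_combination -h)
    · exact mul_ne_zero (pow_ne_zero 8 h2) (pow_ne_zero 2 h3) (by linear_combination -h)
  · obtain rfl : c = 20 := by linear_combination hv0
    rcases key with h | h | h
    · exact h11 (by linear_combination h)
    · exact pow_ne_zero 2 h2 (by linear_combination h)
    · exact mul_ne_zero (pow_ne_zero 4 h2) h131 (by linear_combination h)
  · rcases key with h | h | h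
    · refine mul_ne_zero (pow_ne_zero 3 h3) h3541 ?_
      have hG : 9 - 30 * v + 10 * v ^ 3 = 0 := by linear_combination hv0 - h
      linear_combination (36330 + 2100 * v - 11300 * v ^ 2) * hF
        + (-25707 - 3020 * v + 10170 * v ^ 2) * hG
    · refine mul_ne_zero (pow_ne_zero 3 h2) h599 ?_
      have hG : 16 - 30 * v + 10 * v ^ 3 = 0 := by linear_combination hv0 - h
      linear_combination (-5880 + 3850 * v + 3450 * v ^ 2) * hF
        + (3607 - 3120 * v - 3105 * v ^ 2) * hG
    · refine mul_ne_zero (mul_ne_zero (pow_ne_zero 4 h2) (pow_ne_zero 5 h3))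
        (mul_ne_zero (pow_ne_zero 3 h7) h8009) ?_
      have hS : 9 * (c - 8) = 18 + 60 * v - 10 * v ^ 2 := by
        linear_combination 9 * hv0 - 10 * hF
      have hG : -25236 + 13200 * v + 8600 * v ^ 2 - 3600 * v ^ 3 + 300 * v ^ 4 = 0 := by
        linear_combination 9 * h
          - (3 * (9 * (c - 8) + (18 + 60 * v - 10 * v ^ 2)) + 112) * hS
      linear_combination
        (21150251400 + 5511595700 * v - 3796672500 * v ^ 2 + 352740000 * v ^ 3) * hF
        + (7119654 - 11910425 * v - 10582200 * v ^ 2) * hG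

lemma elem5 {k : Type*} [Field k] (H : GoodField k) {b c d u v w : k}
    (hu : u * (u ^ 4 + b * u ^ 2 + c * u + d) = 0) (hu0 : 10 * u ^ 2 + b = 0)
    (hv : v * (v ^ 4 + b * v ^ 2 + c * v + d) = 0) (hv0 : 10 * v ^ 3 + 3 * b * v + c = 0)
    (hw : w * (w ^ 4 + b * w ^ 2 + c * w + d) = 0)
    (hw0 : 5 * w ^ 4 + 3 * b * w ^ 2 + 2 * c * w + d = 0) :
    b = 0 ∧ c = 0 ∧ d = 0 := by
  by_cases u0 : u = 0
  · subst u0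
    obtain rfl : b = 0 := by linear_combination hu0
    refine ⟨rfl, ?_⟩
    by_cases v0 : v = 0
    · subst v0
      obtain rfl : c = 0 := by linear_combination hv0
      refine ⟨rfl, ?_⟩
      by_cases w0 : w = 0
      · subst w0; linear_combination hw0
      · exfalso
        apply mul_ne_zero (pow_ne_zero 2 H.h2) (pow_ne_zero 5 w0)
        linear_combination w * hw0 - hw
    · exfalso
      have hd : d = 9 * v ^ 4 := by
        apply mul_left_cancel₀ v0
        linear_combination hv - v ^ 2 * hv0
      have hc : c = - 10 * v ^ 3 := by linear_combination hv0
      subst hd hc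
      by_cases w0 : w = 0
      · subst w0
        exact mul_ne_zero (pow_ne_zero 2 H.h3) (pow_ne_zero 4 v0) (by linear_combination hw0)
      have e1 : w ^ 4 - 10 * v ^ 3 * w + 9 * v ^ 4 = 0 := by
        apply mul_left_cancel₀ w0
        linear_combination hw
      have h6 : (6 : k) ≠ 0 := by
        have := mul_ne_zero H.h2 H.h3; norm_num at this; exact this
      have e2 : 5 * w = 6 * v := by
        apply mul_left_cancel₀ (mul_ne_zero h6 (pow_ne_zero 3 v0))
        linear_combination hw0 - 5 * e1
      refine mul_ne_zero (mul_ne_zero H.h3 H.h193) (pow_ne_zero 4 v0) ?_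
      linear_combination (-625) * e1 +
        ((5 * w) ^ 3 + (5 * w) ^ 2 * (6 * v) + (5 * w) * (6 * v) ^ 2 + (6 * v) ^ 3
          - 1250 * v ^ 3) * e2
  · exfalso
    have hb : b = -10 * u ^ 2 := by linear_combination hu0
    have hd : d = 9 * u ^ 4 - c * u := by
      apply mul_left_cancel₀ u0
      linear_combination hu - u ^ 3 * hu0
    obtain ⟨v, rfl⟩ : ∃ v', v = u * v' := ⟨v / u, by field_simp⟩
    obtain ⟨w, rfl⟩ : ∃ v', w = u * v' := ⟨w / u, by field_simp⟩
    obtain ⟨c, rfl⟩ : ∃ v', c = u ^ 3 * v' := ⟨c / u ^ 3, by field_simp⟩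
    subst hb hd
    have hc : c = 30 * v - 10 * v ^ 3 := by
      apply mul_left_cancel₀ (pow_ne_zero 3 u0)
      linear_combination hv0
    refine core_uv H (c := c) (v := v) (w := w) hc ?_ ?_ ?_
    · by_cases v0 : v = 0
      · exact Or.inl v0
      by_cases v1 : v = 1
      · exact Or.inr (Or.inl v1)
      right; right
      apply mul_left_cancel₀ (mul_ne_zero (mul_ne_zero v0 (sub_ne_zero.2 v1)) (pow_ne_zero 5 u0))
      subst hc
      linear_combination -hv
    · apply mul_left_cancel₀ (pow_ne_zero 5 u0)
      linear_combination hw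
    · apply mul_left_cancel₀ (pow_ne_zero 4 u0)
      linear_combination hw0

/-- Casas-Alvero in degree `m` over `k`, in terms of rational common roots -/
def CARoots (k : Type*) [Field k] (m : ℕ) : Prop :=
  ∀ Q : k[X], Q.Monic → Q.natDegree = m →
    (∀ i, 1 ≤ i → i < m → ∃ x, Q.eval x = 0 ∧ (hasseDeriv i Q).eval x = 0) →
    ∃ r, Q = (X - C r) ^ m

lemma caRoots_one (k : Type*) [Field k] : CARoots k 1 := by
  intro Q hQ hd _
  refine ⟨-Q.coeff 0, ?_⟩
  rw [pow_one, map_neg, sub_neg_eq_add]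
  exact hQ.eq_X_add_C hd

lemma caRoots_five {k : Type*} [Field k] (H : GoodField k) : CARoots k 5 := by
  intro Q hQ hd h
  obtain ⟨s, hs, hs4⟩ := h 4 (by norm_num) (by norm_num)
  have hT : (taylor s Q).natDegree = 5 := by rw [natDegree_taylor, hd]
  have hc : ∀ i, (taylor s Q).coeff i = (hasseDeriv i Q).eval s := fun i => taylor_coeff s Q i
  set T := taylor s Q with hTdef
  have hroot : ∀ i, 1 ≤ i → i < 5 → ∃ x, T.eval x = 0 ∧ (hasseDeriv i T).eval x = 0 := by
    intro i h1 h2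
    obtain ⟨x, hx, hx'⟩ := h i h1 h2
    refine ⟨x - s, ?_, ?_⟩
    · rw [hTdef, taylor_eval_sub, hx]
    · rw [← taylor_coeff, hTdef, taylor_taylor, sub_add_cancel, taylor_coeff, hx']
  have c5 : T.coeff 5 = 1 := by
    have := leadingCoeff_taylor s Q
    rw [hQ.leadingCoeff, leadingCoeff, natDegree_taylor, hd] at this
    exact this
  have c4 : T.coeff 4 = 0 := by rw [hc, hs4]
  have c0 : T.coeff 0 = 0 := by rw [hc]; simpa using hs
  have e0 : ∀ x, T.eval x = x * (x ^ 4 + T.coeff 3 * x ^ 2 + T.coeff 2 * x + T.coeff 1) := by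
    intro x
    rw [eval_eq_sum_range' (n := 6) (by omega)]
    simp only [Finset.sum_range_succ, Finset.sum_range_zero, c5, c4, c0]
    ring
  have hnd : ∀ i, (hasseDeriv i T).natDegree < 6 := fun i =>
    lt_of_le_of_lt (natDegree_hasseDeriv_le T i) (by omega)
  have c6 : ∀ j, 6 ≤ j → T.coeff j = 0 := fun j hj => coeff_eq_zero_of_natDegree_lt (by omega)
  have e3 : ∀ x, (hasseDeriv 3 T).eval x = 10 * x ^ 2 + T.coeff 3 := by
    intro x
    rw [eval_eq_sum_range' (hnd 3)]
    simp [Finset.sum_range_succ, hasseDeriv_coeff, c5, c4, c6, Nat.choose]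
    ring
  have e2 : ∀ x, (hasseDeriv 2 T).eval x = 10 * x ^ 3 + 3 * T.coeff 3 * x + T.coeff 2 := by
    intro x
    rw [eval_eq_sum_range' (hnd 2)]
    simp [Finset.sum_range_succ, hasseDeriv_coeff, c5, c4, c6, Nat.choose]
    ring
  have e1 : ∀ x, (hasseDeriv 1 T).eval x
      = 5 * x ^ 4 + 3 * T.coeff 3 * x ^ 2 + 2 * T.coeff 2 * x + T.coeff 1 := by
    intro x
    rw [eval_eq_sum_range' (hnd 1)]
    simp only [Finset.sum_range_succ, hasseDeriv_coeff]
    simp [c5, c4, c6]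
    ring
  obtain ⟨u, hu, hu0⟩ := hroot 3 (by norm_num) (by norm_num)
  obtain ⟨v, hv, hv0⟩ := hroot 2 (by norm_num) (by norm_num)
  obtain ⟨w, hw, hw0⟩ := hroot 1 (by norm_num) (by norm_num)
  rw [e0] at hu hv hw
  rw [e3] at hu0
  rw [e2] at hv0
  rw [e1] at hw0
  obtain ⟨c3, c2, c1⟩ := elem5 H hu hu0 hv hv0 hw hw0
  refine ⟨s, ?_⟩
  apply taylor_injective s
  rw [← hTdef, taylor_pow, map_sub, taylor_X, taylor_C, add_sub_cancel_right]
  ext j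
  rw [coeff_X_pow]
  rcases lt_or_ge j 6 with hj | hj
  · interval_cases j <;> simp [c0, c1, c2, c3, c4, c5]
  · rw [c6 j hj, if_neg (by omega)]

lemma choose_expand {k : Type*} [Field k] (p : ℕ) [Fact p.Prime] [CharP k p] (e s j : ℕ) :
    (((p ^ e * s).choose j : ℕ) : k) = if p ^ e ∣ j then ((s.choose (j / p ^ e) : ℕ) : k) else 0 := by
  have hq : 0 < p ^ e := pow_pos (Fact.out : p.Prime).pos e
  have h : ((1 : k[X]) + X) ^ (p ^ e * s) = expand k (p ^ e) ((1 + X) ^ s) := by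
    rw [pow_mul, map_pow, map_add, map_one, expand_X, add_pow_char_pow, one_pow]
  rw [← coeff_one_add_X_pow, h, coeff_expand hq, coeff_one_add_X_pow]

lemma charp_step {k : Type*} [Field k] (p : ℕ) [Fact p.Prime] [CharP k p] (e m : ℕ)
    (hm : 0 < m) (hCA : CARoots k m) (P : k[X]) (hP : P.Monic) (hd : P.natDegree = m * p ^ e)
    (h : ∀ i, 1 ≤ i → i < m * p ^ e → ∃ x, P.eval x = 0 ∧ (hasseDeriv i P).eval x = 0)
    (h0 : P.eval 0 = 0) : P = X ^ (m * p ^ e) := by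
  have hq : 0 < p ^ e := pow_pos (Fact.out : p.Prime).pos e
  have hcoeff : ∀ l j, l + j = m * p ^ e → ¬ p ^ e ∣ j → P.coeff j = 0 := by
    intro l
    induction l using Nat.strong_induction_on with
    | _ l ih =>
      intro j hlj hj
      have hj0 : j ≠ 0 := by rintro rfl; exact hj (dvd_zero _)
      have hl0 : l ≠ 0 := by
        rintro rfl; apply hj; rw [zero_add] at hlj; rw [hlj]; exact dvd_mul_left _ _
      obtain ⟨x, -, hx⟩ := h j (by omega) (by omega)
      have hC : hasseDeriv j P = C (P.coeff j) := by
        ext t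
        rw [hasseDeriv_coeff, coeff_C]
        split_ifs with ht
        · subst ht; simp
        · by_cases hdv : p ^ e ∣ t + j
          · obtain ⟨s, hs⟩ := hdv
            rw [hs, choose_expand p, if_neg hj, zero_mul]
          · rcases le_or_gt (t + j) (m * p ^ e) with hle | hgt
            · rw [ih (l - t) (by omega) (t + j) (by omega) hdv, mul_zero]
            · rw [coeff_eq_zero_of_natDegree_lt (by omega), mul_zero]
      rwa [hC, eval_C] at hx
  have hcoeff' : ∀ j, ¬ p ^ e ∣ j → P.coeff j = 0 := by
    intro j hj
    rcases le_or_gt j (m * p ^ e) with hle | hgt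
    · exact hcoeff (m * p ^ e - j) j (by omega) hj
    · exact coeff_eq_zero_of_natDegree_lt (by omega)
  set Q := contract (p ^ e) P with hQdef
  have hPQ : P = expand k (p ^ e) Q := by
    ext j
    rw [coeff_expand hq]
    split_ifs with hj
    · rw [hQdef, coeff_contract hq.ne', Nat.div_mul_cancel hj]
    · exact hcoeff' j hj
  have hQd : Q.natDegree = m := by
    have : P.natDegree = Q.natDegree * p ^ e := by
      conv_lhs => rw [hPQ]
      exact natDegree_expand _ _
    rw [hd] at this
    exact (Nat.eq_of_mul_eq_mul_right hq this).symm
  have hQm : Q.Monic := by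
    rw [hPQ] at hP
    exact (monic_expand_iff hq).1 hP
  have hder : ∀ i, hasseDeriv (p ^ e * i) P = expand k (p ^ e) (hasseDeriv i Q) := by
    intro i
    ext t
    rw [hasseDeriv_coeff, coeff_expand hq]
    split_ifs with ht
    · obtain ⟨t, rfl⟩ := ht
      rw [← mul_add, choose_expand p, if_pos (dvd_mul_right _ _), hPQ, coeff_expand_mul' hq,
        Nat.mul_div_cancel_left _ hq, Nat.mul_div_cancel_left _ hq, hasseDeriv_coeff]
    · rw [hcoeff' _ (fun hh => ht ((Nat.dvd_add_left (dvd_mul_right _ _)).1 hh)), mul_zero]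
  obtain ⟨r, hr⟩ := hCA Q hQm hQd (by
    intro i h1 h2
    obtain ⟨x, hx, hx'⟩ := h (p ^ e * i) (Nat.mul_pos hq h1)
      (by rw [mul_comm]; exact Nat.mul_lt_mul_of_pos_right h2 hq)
    refine ⟨x ^ p ^ e, ?_, ?_⟩
    · rw [← expand_eval, ← hPQ, hx]
    · rw [← expand_eval, ← hder, hx'])
  have hr0 : r = 0 := by
    rw [hPQ, expand_eval, hr, zero_pow hq.ne'] at h0
    simpa [hm.ne'] using h0
  rw [hPQ, hr, hr0]
  simp [← pow_mul, mul_comm]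

lemma exists_val {K : Type*} [Field K] [CharZero K] (p : ℕ) (hp : p.Prime) :
    ∃ A : ValuationSubring K, CharP (IsLocalRing.ResidueField A) p := by
  let R : Subring K := (Int.castRingHom K).range
  let I : Ideal R := Ideal.span {(p : R)}
  have hI : I ≠ ⊤ := by
    intro h
    rw [Ideal.span_singleton_eq_top] at h
    obtain ⟨⟨y, z, rfl⟩, hy⟩ := h.exists_right_inv
    have hy' := congrArg (Subtype.val) hy
    have : ((p : ℤ) * z : ℤ) = 1 := by
      have : (((p : ℤ) * z : ℤ) : K) = (1 : ℤ) := by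
        push_cast
        simpa using hy'
      exact_mod_cast this
    have h1 : (p : ℤ) ∣ 1 := ⟨z, this.symm⟩
    have : p ∣ 1 := by exact_mod_cast h1
    exact hp.one_lt.ne' (Nat.dvd_one.1 this)
  obtain ⟨B, hRB, hB⟩ := Ideal.image_subset_nonunits_valuationSubring I hI
  refine ⟨B, ?_⟩
  have hpB : (p : K) ∈ (B.nonunits : Set K) := hB ⟨(p : R), Ideal.mem_span_singleton_self _, by simp⟩
  have : ((p : ℕ) : IsLocalRing.ResidueField B) = 0 := by
    rw [← map_natCast (IsLocalRing.residue B), IsLocalRing.residue_eq_zero_iff]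
    rw [← B.image_maximalIdeal] at hpB
    obtain ⟨y, hy, hy'⟩ := hpB
    have : y = (p : B) := Subtype.ext (by simpa using hy')
    rwa [← this]
  exact (CharP.charP_iff_prime_eq_zero hp).2 this

lemma eval_hasse_comp {K : Type*} [Field K] (P : K[X]) (a b y : K) (i : ℕ) :
    (hasseDeriv i (P.comp (C b * X + C a))).eval y
      = (hasseDeriv i P).eval (b * y + a) * b ^ i := by
  rw [← taylor_coeff, ← taylor_coeff, ← comp_C_mul_X_coeff, taylor_apply, taylor_apply, comp_assoc,
    comp_assoc]
  congr 2
  simp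
  ring

lemma hasseDeriv_map' {R S : Type*} [CommRing R] [CommRing S] (f : R →+* S) (P : R[X]) (i : ℕ) :
    hasseDeriv i (P.map f) = (hasseDeriv i P).map f := by
  ext j
  simp [hasseDeriv_coeff]

lemma comp_prod {K : Type*} [Field K] (a b : K) (hb : b ≠ 0) (s : Multiset K) :
    ((s.map fun x => X - C x).prod).comp (C b * X + C a)
      = C (b ^ s.card) * ((s.map fun x => (x - a) / b).map fun x => X - C x).prod := by
  induction s using Multiset.induction_on with
  | empty => simp
  | cons x s ih =>
    simp only [Multiset.map_cons, Multiset.prod_cons, mul_comp, ih, Multiset.card_cons]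
    have : (X - C x).comp (C b * X + C a) = C b * (X - C ((x - a) / b)) := by
      rw [mul_sub, ← C_mul, mul_div_cancel₀ _ hb]
      simp only [sub_comp, X_comp, C_comp, C_sub]
      ring
    rw [this, pow_succ, C_mul]
    ring

universe u

lemma main_closed {K : Type u} [Field K] [CharZero K] [IsAlgClosed K] (p : ℕ) (hp : p.Prime)
    (e m : ℕ) (hm : 0 < m)
    (hCA : ∀ (k : Type u) [Field k] [CharP k p], CARoots k m) : CARoots K (m * p ^ e) := by
  intro P hP hd h
  have hq : 0 < p ^ e := pow_pos hp.pos e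
  have hn : 0 < m * p ^ e := Nat.mul_pos hm hq
  set n := m * p ^ e with hndef
  obtain ⟨A, hA⟩ := exists_val (K := K) p hp
  have := hA
  have : Fact p.Prime := ⟨hp⟩
  have hsplit : P.Splits := IsAlgClosed.splits P
  have hcard : P.roots.card = n := by rw [← hd]; exact hsplit.natDegree_eq_card_roots.symm
  have hprod : P = (P.roots.map fun x => X - C x).prod := hsplit.eq_prod_roots_of_monic hP
  obtain ⟨a, ha⟩ : ∃ a, a ∈ P.roots := Multiset.card_pos_iff_exists_mem.1 (by omega)
  classical
  obtain ⟨b', hb', hmax⟩ := Finset.exists_max_image P.roots.toFinset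
    (fun x => A.valuation (x - a)) ⟨a, Multiset.mem_toFinset.2 ha⟩
  by_cases hb : b' = a
  · refine ⟨a, ?_⟩
    have hall : ∀ x ∈ P.roots, x = a := by
      intro x hx
      have := hmax x (Multiset.mem_toFinset.2 hx)
      rw [hb, sub_self, map_zero, le_zero_iff, map_eq_zero, sub_eq_zero] at this
      exact this
    rw [Multiset.eq_replicate_card.2 hall, hcard] at hprod
    rw [hprod]; simp
  exfalso
  set b := b' - a with hbdef
  have hb0 : b ≠ 0 := sub_ne_zero.2 hb
  have hint : ∀ x ∈ P.roots, (x - a) / b ∈ A := by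
    intro x hx
    rw [← A.valuation_le_one_iff, map_div₀]
    exact div_le_one_of_le₀ (hmax x (Multiset.mem_toFinset.2 hx)) zero_le
  set M : Multiset K := P.roots.map fun x => (x - a) / b with hM
  set R : K[X] := (M.map fun x => X - C x).prod with hR
  have hRP : P.comp (C b * X + C a) = C (b ^ n) * R := by
    conv_lhs => rw [hprod]
    rw [comp_prod a b hb0, hcard]
  have hMA : ∀ x ∈ M, x ∈ A := by
    intro x hx
    obtain ⟨y, hy, rfl⟩ := Multiset.mem_map.1 hx
    exact hint y hy
  have hRlift : R ∈ lifts (algebraMap A K) := by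
    apply multiset_prod_mem
    intro f hf
    obtain ⟨x, hx, rfl⟩ := Multiset.mem_map.1 hf
    refine (mem_lifts _).2 ⟨X - C (⟨x, hMA x hx⟩ : A), ?_⟩
    rw [Polynomial.map_sub, map_X, map_C]
    rfl
  have hRm : R.Monic := monic_multiset_prod_of_monic _ _ fun x _ => monic_X_sub_C _
  have hRd : R.natDegree = n := by
    rw [hR, natDegree_multiset_prod_X_sub_C_eq_card, hM, Multiset.card_map, hcard]
  have hRroot : ∀ x, R.eval x = 0 → x ∈ M := by
    intro x hx
    rw [hR, eval_multiset_prod, Multiset.prod_eq_zero_iff, Multiset.map_map] at hx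
    obtain ⟨y, hy, hy'⟩ := Multiset.mem_map.1 hx
    simp only [Function.comp, eval_sub, eval_X, eval_C, sub_eq_zero] at hy'
    rwa [hy']
  have hRroot' : ∀ x ∈ M, R.eval x = 0 := by
    intro x hx
    rw [hR, eval_multiset_prod, Multiset.prod_eq_zero_iff, Multiset.map_map]
    exact Multiset.mem_map.2 ⟨x, hx, by simp⟩
  have hbn : b ^ n ≠ 0 := pow_ne_zero _ hb0
  have hRh : ∀ i, 1 ≤ i → i < n → ∃ x, R.eval x = 0 ∧ (hasseDeriv i R).eval x = 0 := by
    intro i h1 h2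
    obtain ⟨x, hx, hx'⟩ := h i h1 h2
    have hbx : b * ((x - a) / b) + a = x := by field_simp; ring
    refine ⟨(x - a) / b, ?_, ?_⟩
    · have := congrArg (eval ((x - a) / b)) hRP
      rw [eval_comp] at this
      simp only [eval_add, eval_mul, eval_C, eval_X, hbx, hx] at this
      exact (mul_eq_zero.1 this.symm).resolve_left hbn
    · have := eval_hasse_comp P a b ((x - a) / b) i
      rw [hRP, hbx, hx', zero_mul, ← smul_eq_C_mul, map_smul, eval_smul, smul_eq_mul] at this
      exact (mul_eq_zero.1 this).resolve_left hbn
  obtain ⟨S, hSR, hSd, hSm⟩ := lifts_and_natDegree_eq_and_monic hRlift hRm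
  have hinj : Function.Injective (algebraMap A K) := IsFractionRing.injective A K
  have hev : ∀ (T : A[X]) (y : A), (T.map (algebraMap A K)).eval (y : K) = 0 →
      (T.map (IsLocalRing.residue A)).eval (IsLocalRing.residue A y) = 0 := by
    intro T y hy
    have h1 : (T.map (algebraMap A K)).eval (algebraMap A K y) = 0 := hy
    rw [eval_map_apply, map_eq_zero_iff _ hinj] at h1
    rw [eval_map_apply, h1, map_zero]
  have h0M : (0 : K) ∈ M := Multiset.mem_map.2 ⟨a, ha, by simp⟩
  have h1M : (1 : K) ∈ M :=
    Multiset.mem_map.2 ⟨b', Multiset.mem_toFinset.1 hb', div_self hb0⟩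
  have hfin := charp_step (k := IsLocalRing.ResidueField A) p e m hm (hCA _)
    (S.map (IsLocalRing.residue A)) (hSm.map _)
    (by rw [hSm.natDegree_map, hSd, hRd])
    (by
      intro i h1 h2
      obtain ⟨x, hx, hx'⟩ := hRh i h1 h2
      refine ⟨IsLocalRing.residue A ⟨x, hMA x (hRroot x hx)⟩, ?_, ?_⟩
      · apply hev
        rw [hSR]; exact hx
      · rw [hasseDeriv_map']
        apply hev
        rw [← hasseDeriv_map', hSR]; exact hx')
    (by
      have := hev S 0 (by rw [hSR]; exact hRroot' _ h0M)
      rwa [map_zero] at this)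
  have h1 := hev S 1 (by rw [hSR]; exact hRroot' _ h1M)
  rw [hfin, map_one, eval_pow, eval_X, one_pow] at h1
  exact one_ne_zero h1

lemma goodField {k : Type*} [Field k] (p : ℕ) (hp : p.Prime) [CharP k p]
    (hp' : p ∉ ({2, 3, 7, 11, 131, 193, 599, 3541, 8009} : Finset ℕ)) (hp5 : p ≠ 5) :
    GoodField k := by
  simp only [Finset.mem_insert, Finset.mem_singleton, not_or] at hp'
  obtain ⟨a1, a2, a3, a4, a5, a6, a7, a8, a9⟩ := hp'
  have key : ∀ l : ℕ, l.Prime → p ≠ l → (l : k) ≠ 0 := by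
    intro l hl hne h
    rw [CharP.cast_eq_zero_iff k p] at h
    exact hne ((Nat.prime_dvd_prime_iff_eq hp hl).1 h)
  constructor
  · exact_mod_cast key 2 (by norm_num) a1
  · exact_mod_cast key 3 (by norm_num) a2
  · exact_mod_cast key 5 (by norm_num) hp5
  · exact_mod_cast key 7 (by norm_num) a3
  · exact_mod_cast key 11 (by norm_num) a4
  · exact_mod_cast key 131 (by norm_num) a5
  · exact_mod_cast key 193 (by norm_num) a6
  · exact_mod_cast key 599 (by norm_num) a7
  · exact_mod_cast key 3541 (by norm_num) a8
  · exact_mod_cast key 8009 (by norm_num) a9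

lemma ca_all {K : Type*} [Field K] [CharZero K] [IsAlgClosed K] (p : ℕ) (hp : p.Prime)
    (hp' : p ∉ ({2, 3, 7, 11, 131, 193, 599, 3541, 8009} : Finset ℕ)) (e : ℕ) :
    CARoots K (5 * p ^ e) := by
  by_cases hp5 : p = 5
  · have := main_closed (K := K) p hp (e + 1) 1 one_pos (fun k _ _ => caRoots_one k)
    rw [one_mul, pow_succ'] at this
    subst hp5
    exact this
  · exact main_closed p hp e 5 (by norm_num)
      (fun k _ _ => caRoots_five (goodField p hp hp' hp5))

theorem casas_alvero_deg_5pe (p : ℕ) (hp : p.Prime)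
    (hp' : p ∉ ({2, 3, 7, 11, 131, 193, 599, 3541, 8009} : Finset ℕ))
    (e : ℕ) (K : Type*) [Field K] [CharZero K]
    (P : K[X]) (hdeg : P.degree = (5 * p ^ e : ℕ))
    (hcop : ∀ i : ℕ, 1 ≤ i → i ≤ 5 * p ^ e - 1 → ¬ IsCoprime P (hasseDeriv i P)) :
    ∃ c r : K, P = C c * (X - C r) ^ (5 * p ^ e) := by
  have hn : 0 < 5 * p ^ e := Nat.mul_pos (by norm_num) (pow_pos hp.pos e)
  have hCA : CARoots (AlgebraicClosure K) (5 * p ^ e) := ca_all p hp hp' e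
  generalize 5 * p ^ e = n at *
  have hP0 : P ≠ 0 := by rintro rfl; simp at hdeg
  have hnd : P.natDegree = n := natDegree_eq_of_degree_eq_some hdeg
  set c := P.leadingCoeff with hc
  have hc0 : c ≠ 0 := leadingCoeff_ne_zero.2 hP0
  set Q : K[X] := C c⁻¹ * P with hQ
  have hPQ : P = C c * Q := by rw [hQ, ← mul_assoc, ← C_mul, mul_inv_cancel₀ hc0, C_1, one_mul]
  have hQm : Q.Monic := by
    rw [hQ, mul_comm]; exact monic_mul_leadingCoeff_inv hP0
  have hQd : Q.natDegree = n := by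
    rw [hQ, natDegree_C_mul (inv_ne_zero hc0), hnd]
  let f := algebraMap K (AlgebraicClosure K)
  obtain ⟨r, hr⟩ := hCA (Q.map f) (hQm.map f) (by rw [hQm.natDegree_map, hQd]) (by
    intro i h1 h2
    have := hcop i h1 (by omega)
    have := mt (isCoprime_iff_aeval_ne_zero_of_isAlgClosed K (AlgebraicClosure K) P _).2 this
    push Not at this
    obtain ⟨x, hx, hx'⟩ := this
    refine ⟨x, ?_, ?_⟩
    · rw [eval_map_algebraMap, hQ, map_mul, hx, mul_zero]
    · rw [hasseDeriv_map', eval_map_algebraMap, hQ, ← smul_eq_C_mul, map_smul, map_smul, hx',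
        smul_zero])
  have hn0 : (n : K) ≠ 0 := Nat.cast_ne_zero.2 hn.ne'
  have hcf := congrArg nextCoeff hr
  rw [nextCoeff_map f.injective, Monic.nextCoeff_pow (monic_X_sub_C r), nextCoeff_X_sub_C] at hcf
  have hr' : r = f (-Q.nextCoeff / n) := by
    have hn1 : (n : AlgebraicClosure K) ≠ 0 := Nat.cast_ne_zero.2 hn.ne'
    rw [map_div₀, map_neg, hcf, map_natCast, nsmul_eq_mul]
    field_simp
  refine ⟨c, -Q.nextCoeff / n, ?_⟩
  have : Q = (X - C (-Q.nextCoeff / n)) ^ n := by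
    apply map_injective f f.injective
    rw [hr, hr']
    simp
  conv_lhs => rw [hPQ, this]
end

section
/- Let p be a prime number with p ∉ {3, 5, 7}, let e be a natural number, and let K be a field of characteristic 0. If P ∈ K[X] is a polynomial of degree n = 4·p^e such that for every integer i with 1 ≤ i ≤ n−1 the polynomials P and its i-th Hasse derivative are not coprime, then there exist c, r ∈ K such that P = c·(X − r)^n. -/
open Polynomial

namespace CasasAux

def CA {k : Type*} [CommRing k] (f : k[X]) (n : ℕ) : Prop :=
  ∀ i, 1 ≤ i → i < n → ∃ r, f.eval r = 0 ∧ (hasseDeriv i f).eval r = 0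

lemma choose_zero {k : Type*} [Field k] {p : ℕ} (hp : p.Prime) [CharP k p] {e N i : ℕ}
    (hN : p ^ e ∣ N) (hi : ¬ p ^ e ∣ i) : ((N.choose i : ℕ) : k) = 0 := by
  rw [CharP.cast_eq_zero_iff k p]
  by_contra h
  apply hi
  rcases i with _ | i
  · simp
  rcases N with _ | N
  · simp at h
  have h1 : (N + 1).choose (i + 1) * (i + 1) = (N + 1) * N.choose i := 
    (Nat.add_one_mul_choose_eq N i).symm
  have h2 : p ^ e ∣ (N + 1).choose (i + 1) * (i + 1) := h1 ▸ (hN.mul_right _)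
  exact (Nat.Coprime.pow_left e ((Nat.Prime.coprime_iff_not_dvd hp).2 h)).dvd_of_dvd_mul_left h2

lemma choose_lucas {p : ℕ} (hp : p.Prime) (e a b : ℕ) :
    (a * p ^ e).choose (b * p ^ e) ≡ a.choose b [MOD p] := by
  haveI := Fact.mk hp
  induction e with
  | zero => simp; rfl
  | succ e ih =>
    refine Nat.ModEq.trans ?_ ih
    have := Choose.choose_modEq_choose_mod_mul_choose_div_nat (p := p)
      (n := a * p ^ (e + 1)) (k := b * p ^ (e + 1))
    rw [pow_succ, ← mul_assoc, ← mul_assoc, Nat.mul_mod_left, Nat.mul_mod_left,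
      Nat.mul_div_cancel _ hp.pos, Nat.mul_div_cancel _ hp.pos] at this
    rw [pow_succ, ← mul_assoc, ← mul_assoc]
    simpa using this

lemma coeff_zero {k : Type*} [Field k] {p : ℕ} (hp : p.Prime) [CharP k p] {e m : ℕ}
    (f : k[X]) (hd : f.natDegree = m * p ^ e) (h : CA f (m * p ^ e)) :
    ∀ j i, m * p ^ e < i + j → ¬ p ^ e ∣ i → f.coeff i = 0 := by
  intro j
  induction j with
  | zero => intro i hi _; exact coeff_eq_zero_of_natDegree_lt (by omega)
  | succ j ih =>
    intro i hij hi
    by_cases hj : m * p ^ e < i + j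
    · exact ih i hj hi
    have hi0 : i ≠ 0 := by rintro rfl; simp at hi
    rcases eq_or_ne i (m * p ^ e) with h1 | h1
    · exact absurd (h1 ▸ Dvd.intro_left _ rfl) hi
    obtain ⟨r, -, hr⟩ := h i (by omega) (by omega)
    have hC : hasseDeriv i f = C (f.coeff i) := by
      ext l
      rw [hasseDeriv_coeff, coeff_C]
      split_ifs with hl
      · subst hl; simp
      · by_cases hq : p ^ e ∣ l + i
        · rw [choose_zero hp hq hi, zero_mul]
        · rw [ih (l + i) (by omega) hq, mul_zero]
    rw [hC, eval_C] at hr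
    exact hr

lemma reduce {k : Type*} [Field k] {p : ℕ} (hp : p.Prime) [CharP k p] {e m : ℕ}
    (f : k[X]) (hm : f.Monic) (hd : f.natDegree = m * p ^ e) (h : CA f (m * p ^ e)) :
    ∃ Q : k[X], Q.Monic ∧ Q.natDegree = m ∧ f = expand k (p ^ e) Q ∧ CA Q m := by
  have hq : 0 < p ^ e := pow_pos hp.pos e
  have hf : f = expand k (p ^ e) (contract (p ^ e) f) := by
    ext i
    rw [coeff_expand hq, coeff_contract hq.ne']
    split_ifs with hi
    · rw [Nat.div_mul_cancel hi]
    · exact coeff_zero hp f hd h (m * p ^ e + 1) i (by omega) hi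
  have hQd : (contract (p ^ e) f).natDegree = m := by
    have := natDegree_expand (p ^ e) (contract (p ^ e) f)
    rw [← hf, hd] at this
    exact (Nat.eq_of_mul_eq_mul_right hq this).symm
  refine ⟨contract (p ^ e) f, ?_, hQd, hf, ?_⟩
  · rw [Monic, leadingCoeff, hQd, coeff_contract hq.ne', ← hd]; exact hm
  · intro i hi him
    obtain ⟨r, hr, hr'⟩ := h (i * p ^ e) (Nat.mul_pos hi hq) (Nat.mul_lt_mul_of_pos_right him hq)
    refine ⟨r ^ (p ^ e), ?_, ?_⟩
    · rw [hf, expand_eval] at hr; exact hr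
    · have : hasseDeriv (i * p ^ e) f = expand k (p ^ e) (hasseDeriv i (contract (p ^ e) f)) := by
        ext l
        rw [hasseDeriv_coeff, coeff_expand hq]
        split_ifs with hl
        · obtain ⟨l, rfl⟩ := hl
          rw [Nat.mul_div_cancel_left _ hq, hasseDeriv_coeff, coeff_contract hq.ne',
            mul_comm (p ^ e) l, ← add_mul]
          congr 1
          exact (CharP.natCast_eq_natCast k p).2 (choose_lucas hp e (l + i) i)
        · rw [coeff_zero hp f hd h (m * p ^ e + 1) _ (by nlinarith), mul_zero]
          rwa [Nat.dvd_add_left (Dvd.intro_left _ rfl)]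
      rw [this, expand_eval] at hr'
      exact hr'

lemma deg_four {k : Type*} [Field k] (h2 : (2 : k) ≠ 0) (h3 : (3 : k) ≠ 0) (h5 : (5 : k) ≠ 0)
    (h7 : (7 : k) ≠ 0) (Q : k[X]) (hm : Q.Monic) (hd : Q.natDegree = 4) (h : CA Q 4) (x y : k)
    (hx : Q.eval x = 0) (hy : Q.eval y = 0) : x = y := by
  have ev : ∀ t, Q.eval t = Q.coeff 0 + Q.coeff 1 * t + Q.coeff 2 * t ^ 2 + Q.coeff 3 * t ^ 3
      + t ^ 4 := by
    intro t
    rw [eval_eq_sum_range, hd]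
    have : Q.coeff 4 = 1 := by rw [← hd]; exact hm
    simp [Finset.sum_range_succ, this]
  have evh : ∀ i, 1 ≤ i → ∀ t, (hasseDeriv i Q).eval t = (i.choose i : k) * Q.coeff i +
      ((i + 1).choose i : k) * Q.coeff (i+1) * t + ((i + 2).choose i : k) * Q.coeff (i+2) * t ^ 2
       + ((i + 3).choose i : k) * Q.coeff (i+3) * t ^ 3 := by
    intro i hi t
    rw [eval_eq_sum_range' (n := 4)
      (lt_of_le_of_lt (natDegree_hasseDeriv_le Q i) (by omega))]
    simp [Finset.sum_range_succ, hasseDeriv_coeff, add_comm _ i]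
  have c4 : Q.coeff 4 = 1 := by rw [← hd]; exact hm
  have c5 : Q.coeff 5 = 0 := coeff_eq_zero_of_natDegree_lt (by omega)
  have c6 : Q.coeff 6 = 0 := coeff_eq_zero_of_natDegree_lt (by omega)
  obtain ⟨r, hr, hr'⟩ := h 3 (by norm_num) (by norm_num)
  obtain ⟨s, hs, hs'⟩ := h 2 (by norm_num) (by norm_num)
  obtain ⟨t, ht, ht'⟩ := h 1 (by norm_num) (by norm_num)
  rw [evh _ (by norm_num)] at hr' hs' ht'
  rw [ev] at hr hs ht hx hy
  norm_num [Nat.choose, c4, c5, c6] at hr' hs' ht'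
  generalize Q.coeff 0 = a0 at *
  generalize Q.coeff 1 = a1 at *
  generalize Q.coeff 2 = a2 at *
  generalize Q.coeff 3 = a3 at *
  have e3 : a3 = -4 * r := by linear_combination hr'
  subst e3
  obtain ⟨s, rfl⟩ : ∃ s', s = s' + r := ⟨s - r, by ring⟩
  obtain ⟨t, rfl⟩ : ∃ s', t = s' + r := ⟨t - r, by ring⟩
  obtain ⟨x, rfl⟩ : ∃ s', x = s' + r := ⟨x - r, by ring⟩
  obtain ⟨y, rfl⟩ : ∃ s', y = s' + r := ⟨y - r, by ring⟩
  obtain ⟨b, rfl⟩ : ∃ b, a2 = b + 6 * r ^ 2 := ⟨a2 - 6 * r ^ 2, by ring⟩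
  obtain ⟨c, rfl⟩ : ∃ c, a1 = c - 2 * b * r - 4 * r ^ 3 := ⟨a1 + 2 * b * r + 4 * r ^ 3, by ring⟩
  have e0 : a0 = - c * r + b * r ^ 2 + r ^ 4 := by linear_combination hr
  subst e0
  have hb : b = -6 * s ^ 2 := by linear_combination hs'
  subst hb
  have h1 : s * (c - 5 * s ^ 3) = 0 := by linear_combination hs
  have h2' : t * (t ^ 3 - 6 * s ^ 2 * t + c) = 0 := by linear_combination ht
  have h3' : 4 * t ^ 3 - 12 * s ^ 2 * t + c = 0 := by linear_combination ht'
  have hc : s = 0 ∧ c = 0 := by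
    rcases mul_eq_zero.1 h1 with hs0 | hc
    · subst hs0
      refine ⟨rfl, ?_⟩
      rcases mul_eq_zero.1 h2' with ht0 | ht0
      · subst ht0; linear_combination h3'
      · have : 3 * c = 0 := by linear_combination 4 * ht0 - h3'
        exact (mul_eq_zero.1 this).resolve_left h3
    · have hc' : c = 5 * s ^ 3 := by linear_combination hc
      subst hc'
      suffices hs0 : s = 0 by subst hs0; simp
      rcases mul_eq_zero.1 h2' with ht0 | ht0
      · subst ht0
        have : 5 * s ^ 3 = 0 := by linear_combination h3'
        exact pow_eq_zero_iff (three_ne_zero) |>.1 ((mul_eq_zero.1 this).resolve_left h5)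
      · have e1 : 3 * (s ^ 2 * (4 * t - 5 * s)) = 0 := by linear_combination h3' - 4 * ht0
        rcases mul_eq_zero.1 ((mul_eq_zero.1 e1).resolve_left h3) with e2 | e2
        · exact pow_eq_zero_iff (two_ne_zero) |>.1 e2
        · have : 5 * (7 * s ^ 3) = 0 := by
            linear_combination (-64) * ht0 +
              (16 * t ^ 2 + 20 * t * s + 25 * s ^ 2 - 96 * s ^ 2) * e2
          have := (mul_eq_zero.1 ((mul_eq_zero.1 this).resolve_left h5)).resolve_left h7
          exact pow_eq_zero_iff (three_ne_zero) |>.1 this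
  obtain ⟨rfl, rfl⟩ := hc
  have hx4 : x ^ 4 = 0 := by linear_combination hx
  have hy4 : y ^ 4 = 0 := by linear_combination hy
  rw [pow_eq_zero_iff (by norm_num)] at hx4 hy4
  rw [hx4, hy4]

lemma char_p_case {k : Type*} [Field k] {p : ℕ} (hp : p.Prime) [CharP k p]
    (hp' : p ∉ ({3, 5, 7} : Finset ℕ)) (e : ℕ) (f : k[X]) (hm : f.Monic)
    (hd : f.natDegree = 4 * p ^ e) (h : CA f (4 * p ^ e)) (h0 : f.eval 0 = 0)
    (h1 : f.eval 1 = 0) : False := by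
  have key : ∀ ℓ : ℕ, ℓ.Prime → ℓ ≠ p → (ℓ : k) ≠ 0 := by
    intro ℓ hl hne h
    rw [CharP.cast_eq_zero_iff k p, Nat.prime_dvd_prime_iff_eq hp hl] at h
    exact hne h.symm
  simp only [Finset.mem_insert, Finset.mem_singleton, not_or] at hp'
  by_cases h2 : p = 2
  · subst h2
    have e1 : 4 * 2 ^ e = 1 * 2 ^ (e + 2) := by ring
    rw [e1] at hd h
    obtain ⟨Q, hQ, hQd, rfl, -⟩ := reduce hp f hm hd h
    rw [expand_eval] at h0 h1
    rw [hQ.eq_X_add_C hQd] at h0 h1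
    simp at h0 h1
    simp [h0] at h1
  · obtain ⟨Q, hQ, hQd, rfl, hQc⟩ := reduce hp f hm hd h
    rw [expand_eval] at h0 h1
    have := deg_four (k := k) (by exact_mod_cast key 2 (by norm_num) (by omega))
      (by exact_mod_cast key 3 (by norm_num) (by omega))
      (by exact_mod_cast key 5 (by norm_num) (by omega))
      (by exact_mod_cast key 7 (by norm_num) (by omega)) Q hQ hQd hQc _ _ h0 h1
    simp [hp.ne_zero] at this

lemma exists_val {L : Type*} [Field L] [CharZero L] {p : ℕ} (hp : p.Prime) :
    ∃ A : ValuationSubring L, A.valuation (p : L) < 1 := by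
  let R : Subring L := (Int.castRingHom L).range
  let I : Ideal R := Ideal.span {(p : R)}
  have hI : I ≠ ⊤ := by
    rw [Ne, Ideal.span_singleton_eq_top]
    intro h
    obtain ⟨⟨x, z, hz⟩, hx⟩ := h.exists_right_inv
    have h1 : (p : L) * x = 1 := by simpa using congrArg Subtype.val hx
    rw [← hz] at h1
    have h2 : (p : ℤ) * z = 1 := by
      have : (((p : ℤ) * z : ℤ) : L) = ((1 : ℤ) : L) := by simpa using h1
      exact_mod_cast this
    have := Int.isUnit_iff.1 (IsUnit.of_mul_eq_one z h2)
    have := hp.two_le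
    omega
  obtain ⟨B, -, hB⟩ := Ideal.image_subset_nonunits_valuationSubring I hI
  refine ⟨B, ?_⟩
  have := hB ⟨(p : R), Ideal.subset_span rfl, rfl⟩
  exact (ValuationSubring.mem_nonunits_iff B).1 (by simpa using this)

lemma hasse_map {R S : Type*} [CommRing R] [CommRing S] (φ : R →+* S) (f : R[X]) (i : ℕ) :
    hasseDeriv i (f.map φ) = (hasseDeriv i f).map φ := by
  ext l; simp [hasseDeriv_coeff]

lemma CA_affine {L : Type*} [Field L] (f : L[X]) (n : ℕ) (c d a : L) (hd : d ≠ 0)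
    (h : CA f n) : CA (C c * f.comp (C d * X + C a)) n := by
  intro i hi hin
  obtain ⟨r, hr, hr'⟩ := h i hi hin
  refine ⟨(r - a) / d, ?_, ?_⟩
  · simp [mul_div_cancel₀ _ hd, hr]
  · rw [← taylor_coeff]
    have : taylor ((r - a) / d) (C c * f.comp (C d * X + C a)) =
        C c * (taylor r f).comp (C d * X) := by
      simp only [taylor_apply, mul_comp, C_comp, comp_assoc]
      congr 2
      simp only [add_comp, mul_comp, C_comp, X_comp, mul_add, ← C_mul, mul_div_cancel₀ _ hd,
        add_assoc, ← C_add]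
      simp
    rw [this, coeff_C_mul, comp_C_mul_X_coeff, taylor_coeff, hr']
    simp

lemma normalized {L : Type*} [Field L] [IsAlgClosed L] {p : ℕ} (hp : p.Prime)
    (hp' : p ∉ ({3, 5, 7} : Finset ℕ)) (e : ℕ) (A : ValuationSubring L)
    (hA : A.valuation (p : L) < 1) (g : L[X]) (hm : g.Monic) (hd : g.natDegree = 4 * p ^ e)
    (h : CA g (4 * p ^ e)) (h0 : g.eval 0 = 0) (h1 : g.eval 1 = 0)
    (hr : ∀ x, g.eval x = 0 → x ∈ A) : False := by
  have hl := (IsAlgClosed.splits g).mem_lift_of_roots_mem_range hm A.subtype (by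
    intro a ha
    exact ⟨⟨a, hr a (isRoot_of_mem_roots ha)⟩, rfl⟩)
  obtain ⟨G, hG, hGd, hGm⟩ := lifts_and_natDegree_eq_and_monic hl hm
  have inj : Function.Injective A.subtype := Subtype.val_injective
  have hpk : ((p : ℕ) : IsLocalRing.ResidueField A) = 0 := by
    rw [← map_natCast (IsLocalRing.residue A), IsLocalRing.residue_eq_zero_iff,
      ValuationSubring.valuation_lt_one_iff]
    simpa using hA
  haveI : CharP (IsLocalRing.ResidueField A) p := by
    obtain ⟨q, hq⟩ := CharP.exists (IsLocalRing.ResidueField A)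
    have hqp : q ∣ p := (CharP.cast_eq_zero_iff (IsLocalRing.ResidueField A) q p).1 hpk
    rcases (Nat.dvd_prime hp).1 hqp with h1 | h1
    · exact absurd h1 (CharP.char_ne_one (IsLocalRing.ResidueField A) q)
    · exact h1 ▸ hq
  have evG : ∀ (F : A[X]) (x : A), (F.map A.subtype).eval (x : L) = 0 → 
      (F.map (IsLocalRing.residue A)).eval (IsLocalRing.residue A x) = 0 := by
    intro F x hx
    have : F.eval x = 0 := inj (by
      rw [map_zero, ← eval_map_apply]; exact hx)
    rw [eval_map_apply, this, map_zero]
  refine char_p_case hp hp' e (G.map (IsLocalRing.residue A)) (hGm.map _)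
    (by rw [hGm.natDegree_map, hGd, hd]) ?_ ?_ ?_
  · intro i hi hin
    obtain ⟨r, hr1, hr2⟩ := h i hi hin
    refine ⟨IsLocalRing.residue A ⟨r, hr r hr1⟩, evG _ _ (by rw [hG]; exact hr1), ?_⟩
    rw [hasse_map]
    exact evG _ _ (by rw [← hasse_map, hG]; exact hr2)
  · simpa using evG G 0 (by rw [hG]; exact h0)
  · simpa using evG G 1 (by rw [hG]; exact h1)

lemma closed_case {L : Type*} [Field L] [IsAlgClosed L] [CharZero L] {p : ℕ} (hp : p.Prime)
    (hp' : p ∉ ({3, 5, 7} : Finset ℕ)) (e : ℕ) (f : L[X]) (hd : f.natDegree = 4 * p ^ e)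
    (h : CA f (4 * p ^ e)) (a b : L) (ha : f.eval a = 0) (hb : f.eval b = 0) : a = b := by
  by_contra hab
  have hf0 : f ≠ 0 := by
    rintro rfl
    have := pow_pos hp.pos e
    rw [natDegree_zero] at hd; omega
  classical
  obtain ⟨A, hA⟩ := exists_val (L := L) hp
  obtain ⟨r, hr, hmax⟩ := f.roots.toFinset.exists_max_image (fun x => A.valuation (x - a))
    ⟨a, by simp [hf0, ha]⟩
  simp only [Multiset.mem_toFinset, mem_roots hf0, IsRoot.def] at hr hmax
  have hda : r - a ≠ 0 := by
    intro h0
    have := hmax b hb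
    rw [h0, map_zero, le_zero_iff, map_eq_zero, sub_eq_zero] at this
    exact hab this.symm
  set d := r - a with hdd
  have hlin : (C d * X + C a).natDegree = 1 := natDegree_linear hda
  have hnd : (f.comp (C d * X + C a)).natDegree = 4 * p ^ e := by
    rw [natDegree_comp, hlin, hd, mul_one]
  have hF0 : (f.comp (C d * X + C a)) ≠ 0 := by
    intro h0
    have := pow_pos hp.pos e
    rw [h0, natDegree_zero] at hnd; omega
  set c := (f.comp (C d * X + C a)).leadingCoeff⁻¹ with hc
  have hc0 : c ≠ 0 := inv_ne_zero (leadingCoeff_ne_zero.2 hF0)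
  refine normalized hp hp' e A hA (C c * f.comp (C d * X + C a)) ?_ ?_ (CA_affine f _ c d a hda h)
    ?_ ?_ ?_
  · rw [mul_comm]; exact monic_mul_leadingCoeff_inv hF0
  · rw [natDegree_C_mul hc0, hnd]
  · simp [ha]
  · simp [hdd, hr]
  · intro x hx
    simp [hc0] at hx
    have := hmax _ hx
    rw [add_sub_cancel_right, map_mul] at this
    rw [← ValuationSubring.valuation_le_one_iff]
    have hv : 0 < A.valuation d := by rw [Valuation.pos_iff]; exact hda
    exact (mul_le_iff_le_one_right hv).1 this

end CasasAux

open CasasAux in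
theorem casas_alvero_deg_4pe (p : ℕ) (hp : p.Prime)
    (hp' : p ∉ ({3, 5, 7} : Finset ℕ))
    (e : ℕ) (K : Type*) [Field K] [CharZero K]
    (P : K[X]) (hdeg : P.degree = (4 * p ^ e : ℕ))
    (hcop : ∀ i : ℕ, 1 ≤ i → i ≤ 4 * p ^ e - 1 → ¬ IsCoprime P (hasseDeriv i P)) :
    ∃ c r : K, P = C c * (X - C r) ^ (4 * p ^ e) := by
  have hq := pow_pos hp.pos e
  let L := AlgebraicClosure K
  haveI : CharZero L := charZero_of_injective_algebraMap (algebraMap K L).injective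
  have hnd : P.natDegree = 4 * p ^ e := natDegree_eq_of_degree_eq_some hdeg
  generalize hn : 4 * p ^ e = n at *
  have hn0 : 0 < n := by omega
  let f : L[X] := P.map (algebraMap K L)
  have hfd : f.natDegree = n := by rw [natDegree_map, hnd]
  have hCA : CA f n := by
    intro i hi hin
    have h1 := hcop i hi (by omega)
    rw [isCoprime_iff_aeval_ne_zero_of_isAlgClosed K L] at h1
    push Not at h1
    obtain ⟨a, h2, h3⟩ := h1
    exact ⟨a, by rw [eval_map_algebraMap]; exact h2,
      by rw [hasse_map, eval_map_algebraMap]; exact h3⟩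
  have hall : ∀ a b : L, f.eval a = 0 → f.eval b = 0 → a = b := by
    intro a b
    subst hn
    exact closed_case hp hp' e f hfd hCA a b
  have hs : f.Splits := IsAlgClosed.splits f
  have hfdeg : f.degree ≠ 0 := by
    rw [degree_map, hdeg]; exact_mod_cast hn0.ne'
  obtain ⟨r, hr⟩ := IsAlgClosed.exists_root f hfdeg
  have hroots : f.roots = Multiset.replicate n r := by
    rw [Multiset.eq_replicate]
    refine ⟨by rw [← hfd, hs.natDegree_eq_card_roots], fun b hb => ?_⟩
    exact hall _ _ (isRoot_of_mem_roots hb) hr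
  have hfe : f = C f.leadingCoeff * (X - C r) ^ n := by
    conv_lhs => rw [hs.eq_prod_roots, hroots]
    simp
  have hlead : f.leadingCoeff = algebraMap K L P.leadingCoeff := leadingCoeff_map _
  have hP0 : P.leadingCoeff ≠ 0 := by
    rw [Ne, leadingCoeff_eq_zero]; rintro rfl; simp at hnd; omega
  have hnK : (n : K) ≠ 0 := by exact_mod_cast hn0.ne'
  have hnL : (n : L) ≠ 0 := by exact_mod_cast hn0.ne'
  have hco : algebraMap K L (P.coeff (n - 1)) = algebraMap K L P.leadingCoeff * (- n * r) := by
    have : f.coeff (n - 1) = algebraMap K L (P.coeff (n - 1)) := coeff_map _ _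
    rw [← this, hfe, coeff_C_mul, ← hlead, sub_eq_add_neg, ← C_neg, coeff_X_add_C_pow]
    have h1 : n - (n - 1) = 1 := by omega
    have h2 : n.choose (n - 1) = n := by
      rw [Nat.choose_symm (k := 1) (by omega)]; simp
    rw [h1, h2]; ring
  have hrK : algebraMap K L (- P.coeff (n - 1) / (n * P.leadingCoeff)) = r := by
    rw [map_div₀, map_neg, hco, map_mul, map_natCast]
    have : algebraMap K L P.leadingCoeff ≠ 0 := by simpa using hP0
    rw [div_eq_iff (mul_ne_zero hnL this)]; ring
  refine ⟨P.leadingCoeff, - P.coeff (n - 1) / (n * P.leadingCoeff), ?_⟩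
  apply map_injective _ (algebraMap K L).injective
  simp only [Polynomial.map_mul, map_C, Polynomial.map_pow, Polynomial.map_sub, map_X, hrK]
  rw [← hlead]
  exact hfe
end

section
/- Let p be any prime number, e a natural number, and K a field of characteristic 0. If P ∈ K[X] is a polynomial of degree n = p^e such that for every integer i with 1 ≤ i ≤ n−1 the polynomials P and its i-th Hasse derivative are not coprime, then there exist c, r ∈ K such that P = c·(X − r)^n. -/
open Polynomial

theorem exists_val_aux (p : ℕ) (hp : p.Prime) (L : Type*) [Field L] [CharZero L] :
    ∃ B : ValuationSubring L, B.valuation (p : L) < 1 := by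
  have hI : Ideal.span {((p : ℕ) : (Int.castRingHom L).range)} ≠ ⊤ := by
    rw [Ne, Ideal.span_singleton_eq_top]
    intro h
    obtain ⟨⟨_, m, rfl⟩, hm⟩ := h.exists_right_inv
    have h1 := congrArg Subtype.val hm
    have h2 : ((p : ℤ) : L) * (m : L) = 1 := by simpa using h1
    have h3 : (p : ℤ) * m = 1 := by exact_mod_cast h2
    have h4 : IsUnit (p : ℤ) := .of_mul_eq_one m h3
    exact (Nat.prime_iff_prime_int.mp hp).not_isUnit h4
  obtain ⟨B, -, hB⟩ := Ideal.image_subset_nonunits_valuationSubring _ hI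
  refine ⟨B, ?_⟩
  have := hB ⟨_, Ideal.subset_span rfl, rfl⟩
  simpa [ValuationSubring.mem_nonunits_iff] using this

theorem val_nat_aux {L : Type*} [Field L] (B : ValuationSubring L) (m : ℕ) :
    B.valuation (m : L) ≤ 1 := by
  rw [ValuationSubring.valuation_le_one_iff]
  exact natCast_mem B m

theorem hasse_eval_aux {L : Type*} [Field L] (Q : L[X]) (j : ℕ) (a : L) :
    (hasseDeriv j Q).eval a =
      ∑ k ∈ Finset.range (Q.natDegree + 1), (k.choose j : L) * Q.coeff k * a ^ (k - j) := by
  rw [hasseDeriv_apply, sum_over_range _ (by simp), eval_finsetSum]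
  simp

theorem casas_aux0 (p : ℕ) (hp : p.Prime) (e : ℕ) (L : Type*) [Field L] [CharZero L]
    (Q : L[X]) (hdeg : Q.natDegree = p ^ e) (h0 : Q.coeff 0 = 0)
    (H : ∀ i : ℕ, 1 ≤ i → i < p ^ e → ∃ a, Q.eval a = 0 ∧ (hasseDeriv i Q).eval a = 0) :
    ∀ b, Q.eval b = 0 → b = 0 := by
  classical
  have hn : 0 < p ^ e := pow_pos hp.pos _
  set n := p ^ e with hnn
  have hQ : Q ≠ 0 := by rintro rfl; simp at hdeg; omega
  have hlc : Q.coeff n ≠ 0 := by rw [← hdeg]; simpa using hQ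
  obtain ⟨B, hB⟩ := exists_val_aux p hp L
  set v := B.valuation with hv
  obtain ⟨b, hb, hmax⟩ := Finset.exists_max_image Q.roots.toFinset v
    ⟨0, by simp [hQ, ← coeff_zero_eq_eval_zero, h0]⟩
  have hb : Q.eval b = 0 := by simpa [hQ] using hb
  have hmax : ∀ a, Q.eval a = 0 → v a ≤ v b := fun a ha => hmax a (by simp [hQ, ha])
  by_cases hb0 : b = 0
  · intro a ha
    have := hmax a ha
    rw [hb0, map_zero, le_zero_iff] at this
    simpa using this
  exfalso
  have vb : 0 < v b := by simpa [zero_lt_iff] using hb0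
  have vc : 0 < v (Q.coeff n) := by simpa [zero_lt_iff] using hlc
  have key : ∀ d j, j + d = n → 1 ≤ d → v (Q.coeff j) < v (Q.coeff n) * v b ^ d := by
    intro d
    induction d using Nat.strong_induction_on with
    | _ d ih =>
    intro j hj hd
    have hpos : 0 < v (Q.coeff n) * v b ^ d := mul_pos vc (pow_pos vb _)
    rcases Nat.eq_zero_or_pos j with rfl | hj0
    · rw [h0, map_zero]; exact hpos
    obtain ⟨a, ha, ha'⟩ := H j hj0 (by omega)
    have hab := hmax a ha
    rw [hasse_eval_aux, hdeg, ← Finset.add_sum_erase _ _ (a := j) (by simp; omega)] at ha'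
    simp only [Nat.choose_self, Nat.cast_one, one_mul, Nat.sub_self, pow_zero, mul_one] at ha'
    rw [eq_neg_of_add_eq_zero_left ha', Valuation.map_neg]
    refine Valuation.map_sum_lt' _ hpos fun k hk => ?_
    simp only [Finset.mem_erase, Finset.mem_range] at hk
    rcases lt_or_gt_of_ne hk.1 with hkj | hkj
    · simpa [Nat.choose_eq_zero_of_lt hkj] using hpos
    rw [map_mul, map_mul, map_pow]
    have hpow : v a ^ (k - j) ≤ v b ^ (k - j) := pow_le_pow_left₀ zero_le hab _
    rcases Nat.lt_or_ge k n with hkn | hkn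
    · have h1 := ih (n - k) (by omega) k (by omega) (by omega)
      have hd' : d = (n - k) + (k - j) := by omega
      calc v (k.choose j : L) * v (Q.coeff k) * v a ^ (k - j)
          ≤ 1 * v (Q.coeff k) * v b ^ (k - j) := by
            gcongr
            exact val_nat_aux B _
        _ < v (Q.coeff n) * v b ^ (n - k) * v b ^ (k - j) := by
            rw [one_mul]
            exact mul_lt_mul_of_pos_right h1 (pow_pos vb _)
        _ = _ := by rw [hd', pow_add, mul_assoc]
    · obtain hkn' : k = n := by omega
      subst hkn'
      obtain rfl : d = n - j := by omega
      obtain ⟨m, hm⟩ := hp.dvd_choose_pow (n := e) (k := j) (by omega) (by omega)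
      have h1 : v (n.choose j : L) < 1 := by
        rw [hnn, hm, Nat.cast_mul, map_mul]
        calc v (p : L) * v (m : L) ≤ v (p : L) * 1 := by gcongr; exact val_nat_aux B _
          _ < 1 := by rwa [mul_one]
      calc v (n.choose j : L) * v (Q.coeff n) * v a ^ (n - j)
          ≤ v (n.choose j : L) * (v (Q.coeff n) * v b ^ (n - j)) := by
            rw [mul_assoc]; gcongr
        _ < 1 * (v (Q.coeff n) * v b ^ (n - j)) := mul_lt_mul_of_pos_right h1 hpos
        _ = _ := one_mul _
  rw [eval_eq_sum_range, hdeg, Finset.sum_range_succ] at hb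
  have hpos : 0 < v (Q.coeff n) * v b ^ n := mul_pos vc (pow_pos vb _)
  have h1 : v (∑ k ∈ Finset.range n, Q.coeff k * b ^ k) < v (Q.coeff n) * v b ^ n := by
    refine Valuation.map_sum_lt' _ hpos fun k hk => ?_
    have hk := Finset.mem_range.mp hk
    have h2 := key (n - k) k (by omega) (by omega)
    rw [map_mul, map_pow]
    calc v (Q.coeff k) * v b ^ k < v (Q.coeff n) * v b ^ (n - k) * v b ^ k :=
          mul_lt_mul_of_pos_right h2 (pow_pos vb _)
      _ = _ := by rw [mul_assoc, ← pow_add]; congr 2; omega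
  rw [eq_neg_of_add_eq_zero_left hb, Valuation.map_neg, map_mul, map_pow] at h1
  exact lt_irrefl _ h1

theorem casas_aux1 (p : ℕ) (hp : p.Prime) (e : ℕ) (L : Type*) [Field L] [CharZero L]
    [IsAlgClosed L] (P : L[X]) (hdeg : P.natDegree = p ^ e)
    (H : ∀ i : ℕ, 1 ≤ i → i < p ^ e → ∃ a, P.eval a = 0 ∧ (hasseDeriv i P).eval a = 0) :
    ∃ c r : L, P = C c * (X - C r) ^ (p ^ e) := by
  have hn : 0 < p ^ e := pow_pos hp.pos _
  obtain ⟨r, hr⟩ := IsAlgClosed.exists_root P (by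
    intro h; have := natDegree_eq_of_degree_eq_some (n := 0) h; omega)
  have hP : P ≠ 0 := by rintro rfl; simp at hdeg; omega
  have key := casas_aux0 p hp e L (taylor r P) (by rw [natDegree_taylor, hdeg])
    (by rw [taylor_coeff_zero]; exact hr) (by
      intro i h1 h2
      obtain ⟨a, ha, ha'⟩ := H i h1 h2
      refine ⟨a - r, ?_, ?_⟩
      · rw [taylor_eval]; simpa using ha
      · rw [← taylor_coeff, taylor_taylor, sub_add_cancel, taylor_coeff, ha'])
  have hs := IsAlgClosed.splits P
  have hroots : P.roots = Multiset.replicate (p ^ e) r := by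
    rw [Multiset.eq_replicate]
    refine ⟨by rw [← hdeg, hs.natDegree_eq_card_roots], fun b hb => ?_⟩
    have := key (b - r) (by rw [taylor_eval]; simpa using (mem_roots hP).mp hb)
    exact sub_eq_zero.mp this
  refine ⟨P.leadingCoeff, r, ?_⟩
  conv_lhs => rw [hs.eq_prod_roots, hroots]
  simp

theorem casas_alvero_deg_pe (p : ℕ) (hp : p.Prime)
    (e : ℕ) (K : Type*) [Field K] [CharZero K]
    (P : K[X]) (hdeg : P.degree = (p ^ e : ℕ))
    (hcop : ∀ i : ℕ, 1 ≤ i → i ≤ p ^ e - 1 → ¬ IsCoprime P (hasseDeriv i P)) :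
    ∃ c r : K, P = C c * (X - C r) ^ (p ^ e) := by
  have hn : 0 < p ^ e := pow_pos hp.pos _
  have hd : P.natDegree = p ^ e := natDegree_eq_of_degree_eq_some hdeg
  let L := AlgebraicClosure K
  let f := algebraMap K L
  have : CharZero L := charZero_of_injective_algebraMap f.injective
  have hmap : ∀ i, hasseDeriv i (P.map f) = (hasseDeriv i P).map f := by
    intro i; ext m; simp [hasseDeriv_coeff]
  obtain ⟨c, s, hcs⟩ := casas_aux1 p hp e L (P.map f) (by rw [natDegree_map, hd]) (by
    intro i h1 h2
    have h := hcop i h1 (by omega)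
    rw [isCoprime_iff_aeval_ne_zero_of_isAlgClosed K L] at h
    push Not at h
    obtain ⟨a, ha, hb⟩ := h
    refine ⟨a, ?_, ?_⟩
    · rw [eval_map_algebraMap, ha]
    · rw [hmap, eval_map_algebraMap, hb])
  have hXs : (X - C s : L[X]) = X + C (-s) := by rw [C_neg, sub_eq_add_neg]
  have hc : f (P.coeff (p ^ e)) = c := by
    rw [← coeff_map, hcs, coeff_C_mul, hXs, coeff_X_add_C_pow]; simp
  have hs : f (P.coeff (p ^ e - 1)) = c * (-s * (p ^ e : ℕ)) := by
    rw [← coeff_map, hcs, coeff_C_mul, hXs, coeff_X_add_C_pow,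
      Nat.choose_symm_of_eq_add (Nat.sub_add_cancel hn).symm, Nat.choose_one_right,
      Nat.sub_sub_self hn, pow_one]
  have hc0 : P.coeff (p ^ e) ≠ 0 := by
    rw [← hd]; intro h
    have h2 : P = 0 := leadingCoeff_eq_zero.mp h
    rw [h2] at hd; simp at hd; omega
  have hc0' : c ≠ 0 := by rw [← hc]; simpa using hc0
  have hn0 : ((p ^ e : ℕ) : L) ≠ 0 := by exact_mod_cast hn.ne'
  have hr : f (-(P.coeff (p ^ e - 1)) / (P.coeff (p ^ e) * (p ^ e : ℕ))) = s := by
    rw [map_div₀, map_neg, map_mul, map_natCast, hc, hs]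
    rw [div_eq_iff (mul_ne_zero hc0' hn0)]; ring
  refine ⟨P.coeff (p ^ e), -(P.coeff (p ^ e - 1)) / (P.coeff (p ^ e) * (p ^ e : ℕ)), map_injective f f.injective (hcs.trans ?_)⟩
  rw [Polynomial.map_mul, Polynomial.map_pow, Polynomial.map_sub, map_X, map_C, map_C, hc, hr]
end

section
/- Let p be any prime number, e a natural number, and K a field of characteristic 0. If P ∈ K[X] is a polynomial of degree n = 2·p^e such that for every integer i with 1 ≤ i ≤ n−1 the polynomials P and its i-th Hasse derivative are not coprime, then there exist c, r ∈ K such that P = c·(X − r)^n. -/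
open Polynomial

theorem ca_valEx (L : Type*) [Field L] [CharZero L] (p : ℕ) (hp : p.Prime) :
    ∃ B : ValuationSubring L, B.valuation (p : L) < 1 := by
  let A : Subring L := (Int.castRingHom L).range
  let a : A := (p : A)
  have hI : Ideal.span {a} ≠ ⊤ := by
    rw [Ne, Ideal.span_singleton_eq_top]
    intro h
    obtain ⟨b, hb⟩ := h.exists_right_inv
    obtain ⟨z, hz⟩ := b.2
    have h1 : ((p : ℤ) * z : L) = 1 := by
      have := congrArg (fun t : A => (t : L)) hb
      simp only [Subring.coe_mul, Subring.coe_one, a, Subring.coe_natCast] at this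
      rw [← hz] at this
      simpa using this
    have h2 : (p : ℤ) * z = 1 := by exact_mod_cast h1
    have h3 : (p : ℤ) ∣ 1 := ⟨z, h2.symm⟩
    have h4 : p ∣ 1 := by exact_mod_cast h3
    exact hp.one_lt.ne' (Nat.dvd_one.1 h4)
  obtain ⟨B, -, hB⟩ := Ideal.image_subset_nonunits_valuationSubring _ hI
  refine ⟨B, ?_⟩
  have : (p : L) ∈ B.nonunits := hB ⟨a, Ideal.mem_span_singleton_self a, by simp [a]⟩
  exact (ValuationSubring.mem_nonunits_iff B).1 this

theorem ca_choose (p : ℕ) (hp : p.Prime) (e i : ℕ) (h0 : i ≠ 0) (hq : i ≠ p ^ e)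
    (hn : i ≠ 2 * p ^ e) : p ∣ (2 * p ^ e).choose i := by
  have := Fact.mk hp
  rw [← ZMod.natCast_eq_zero_iff, ← coeff_one_add_X_pow, mul_comm, pow_mul, add_pow_char_pow]
  have : ((1 : (ZMod p)[X]) ^ p ^ e + X ^ p ^ e) ^ 2 = 1 + C 2 * X ^ (p ^ e) + X ^ (2 * p ^ e) := by
    rw [one_pow, mul_comm 2, pow_mul, map_ofNat]; ring
  rw [this]
  simp [coeff_X_pow, coeff_one, h0, hq, hn]

theorem ca_eval {L : Type*} [Field L] (f : L[X]) (i : ℕ) (x : L) :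
    (hasseDeriv i f).eval x =
      ∑ j ∈ Finset.range (f.natDegree + 1), (j.choose i : L) * f.coeff j * x ^ (j - i) := by
  rw [hasseDeriv_apply, sum_over_range, eval_finsetSum]
  · simp
  · simp

theorem ca_core {L : Type*} [Field L] (B : ValuationSubring L) (p : ℕ) (hp : p.Prime) (e : ℕ)
    (hv : B.valuation (p : L) < 1) (f : L[X]) (hf : f ≠ 0) (hn : f.natDegree = 2 * p ^ e)
    (h0 : f.coeff 0 = 0) (hq : f.coeff (p ^ e) = 0)
    (hc : ∀ i, 1 ≤ i → i < 2 * p ^ e → ∃ x, f.eval x = 0 ∧ (hasseDeriv i f).eval x = 0)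
    (s : L) (hs0 : s ≠ 0) (hs : f.eval s = 0)
    (hmax : ∀ x, f.eval x = 0 → B.valuation x ≤ B.valuation s) : False := by
  set v := B.valuation with hvdef
  set n := 2 * p ^ e with hndef
  have hlc : f.coeff n ≠ 0 := by rw [← hn]; simpa using hf
  have hnat : ∀ m : ℕ, v (m : L) ≤ 1 := fun m =>
    (B.valuation_le_one_iff _).2 (natCast_mem B m)
  have hvs : v s ≠ 0 := by simpa using hs0
  have hvn : v (f.coeff n) ≠ 0 := by simpa using hlc
  have hpos : ∀ k, v (f.coeff n) * v s ^ k ≠ 0 := fun k => mul_ne_zero hvn (pow_ne_zero _ hvs)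
  have key : ∀ k, 1 ≤ k → k ≤ n → v (f.coeff (n - k)) < v (f.coeff n) * v s ^ k := by
    intro k
    induction k using Nat.strong_induction_on with
    | _ k ih =>
      intro hk1 hkn
      by_cases hi0 : n - k = 0
      · rw [hi0, h0, map_zero]; exact zero_lt_iff.2 (hpos k)
      by_cases hiq : n - k = p ^ e
      · rw [hiq, hq, map_zero]; exact zero_lt_iff.2 (hpos k)
      obtain ⟨x, hx, hx'⟩ := hc (n - k) (by omega) (by omega)
      rw [ca_eval, hn, ← Finset.add_sum_erase _ _ (Finset.mem_range.2 (by omega : n - k < n + 1))]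
        at hx'
      simp only [Nat.choose_self, Nat.cast_one, one_mul, Nat.sub_self, pow_zero, mul_one] at hx'
      rw [eq_neg_of_add_eq_zero_left hx', Valuation.map_neg]
      apply v.map_sum_lt (hpos k)
      intro j hj
      rw [Finset.mem_erase, Finset.mem_range] at hj
      obtain ⟨hj1, hj2⟩ := hj
      rcases lt_or_gt_of_ne hj1 with hlt | hgt
      · rw [Nat.choose_eq_zero_of_lt hlt]
        simpa using zero_lt_iff.2 (hpos k)
      have hxs : v x ^ (j - (n - k)) ≤ v s ^ (j - (n - k)) := pow_le_pow_left' (hmax x hx) _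
      rw [map_mul, map_mul, map_pow]
      rcases Nat.lt_or_ge j n with hjn | hjn
      · have h1 := ih (n - j) (by omega) (by omega) (by omega)
        rw [Nat.sub_sub_self hjn.le] at h1
        have e1 : v s ^ k = v s ^ (n - j) * v s ^ (j - (n - k)) := by
          rw [← pow_add]; congr 1; omega
        rw [e1, ← mul_assoc]
        calc _ ≤ v (f.coeff j) * v s ^ (j - (n - k)) := by
              refine mul_le_mul' ?_ hxs
              simpa using mul_le_mul_left (hnat (j.choose (n - k))) (v (f.coeff j))
          _ < _ := by
              exact mul_lt_mul_of_pos_right h1 (zero_lt_iff.2 (pow_ne_zero _ hvs))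
      · have hjn' : j = n := by omega
        subst hjn'
        have e1 : n - (n - k) = k := by omega
        rw [e1] at hxs ⊢
        have hch : v ((n.choose (n - k) : ℕ) : L) < 1 := by
          obtain ⟨m, hm⟩ := ca_choose p hp e (n - k) hi0 hiq (by omega)
          rw [hm, Nat.cast_mul, map_mul]
          exact mul_lt_one_of_lt_of_le hv (hnat m)
        calc _ ≤ v ((n.choose (n - k) : ℕ) : L) * (v (f.coeff n) * v s ^ k) := by
              rw [mul_assoc]
              exact mul_le_mul' le_rfl (mul_le_mul' le_rfl hxs)
          _ < 1 * (v (f.coeff n) * v s ^ k) :=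
              mul_lt_mul_of_pos_right hch (zero_lt_iff.2 (hpos k))
          _ = _ := one_mul _
  rw [eval_eq_sum_range, hn, Finset.sum_range_succ] at hs
  have h2 : v (f.coeff n * s ^ n) < v (f.coeff n) * v s ^ n := by
    rw [eq_neg_of_add_eq_zero_right hs, Valuation.map_neg]
    apply v.map_sum_lt (hpos n)
    intro j hj
    rw [Finset.mem_range] at hj
    have h1 := key (n - j) (by omega) (by omega)
    rw [Nat.sub_sub_self hj.le] at h1
    have e1 : v s ^ n = v s ^ (n - j) * v s ^ j := by
      rw [← pow_add]; congr 1; omega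
    rw [e1, ← mul_assoc, map_mul, map_pow]
    exact mul_lt_mul_of_pos_right h1 (zero_lt_iff.2 (pow_ne_zero _ hvs))
  rw [map_mul, map_pow] at h2
  exact lt_irrefl _ h2

theorem ca_common {L : Type*} [Field L] [IsAlgClosed L] (f g : L[X]) (h : ¬ IsCoprime f g) :
    ∃ x, f.eval x = 0 ∧ g.eval x = 0 := by
  by_contra! hh
  apply h
  rw [isCoprime_iff_aeval_ne_zero_of_isAlgClosed L L]
  intro a
  by_cases ha : f.eval a = 0
  · right; simpa using hh a ha
  · left; simpa using ha

theorem casas_alvero_deg_2pe (p : ℕ) (hp : p.Prime)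
    (e : ℕ) (K : Type*) [Field K] [CharZero K]
    (P : K[X]) (hdeg : P.degree = (2 * p ^ e : ℕ))
    (hcop : ∀ i : ℕ, 1 ≤ i → i ≤ 2 * p ^ e - 1 → ¬ IsCoprime P (hasseDeriv i P)) :
    ∃ c r : K, P = C c * (X - C r) ^ (2 * p ^ e) := by
  have hqpos : 0 < p ^ e := pow_pos hp.pos e
  let L := AlgebraicClosure K
  let φ := algebraMap K L
  have hφ : Function.Injective φ := φ.injective
  have : CharZero L := charZero_of_injective_algebraMap hφ
  obtain ⟨B, hv⟩ := ca_valEx L p hp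
  let Q : L[X] := P.map φ
  have hP0 : P ≠ 0 := by
    intro h
    rw [h, degree_zero] at hdeg
    exact WithBot.bot_ne_coe hdeg
  have hQ0 : Q ≠ 0 := by simpa [Q] using hP0
  have hPn : P.natDegree = 2 * p ^ e := natDegree_eq_of_degree_eq_some hdeg
  have hQn : Q.natDegree = 2 * p ^ e := by rw [← hPn]; exact natDegree_map φ
  have hH : ∀ i, hasseDeriv i Q = (hasseDeriv i P).map φ := by
    intro i; ext k; simp [Q, hasseDeriv_coeff]
  have hroot : ∀ i, 1 ≤ i → i < 2 * p ^ e →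
      ∃ x, Q.eval x = 0 ∧ (hasseDeriv i Q).eval x = 0 := by
    intro i h1 h2
    apply ca_common
    rw [hH, isCoprime_map]
    exact hcop i h1 (by omega)
  obtain ⟨r, hr, hr'⟩ := hroot (p ^ e) hqpos (by omega)
  set f := taylor r Q with hfdef
  have hf0 : f ≠ 0 := by
    intro h; exact hQ0 (taylor_injective r (by rw [← hfdef, h, map_zero]))
  have hfn : f.natDegree = 2 * p ^ e := by rw [hfdef, natDegree_taylor, hQn]
  have hev : ∀ i x, (hasseDeriv i f).eval x = (hasseDeriv i Q).eval (x + r) := by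
    intro i x
    rw [← taylor_coeff, ← taylor_coeff, hfdef, taylor_taylor]
  have hall : ∀ x, f.eval x = 0 → x = 0 := by
    by_contra! hne
    obtain ⟨y, hy, hy0⟩ := hne
    classical
    obtain ⟨s, hs, hsm⟩ := Finset.exists_max_image f.roots.toFinset (fun x => B.valuation x)
      ⟨y, by simp [hf0, hy]⟩
    simp only [Multiset.mem_toFinset, mem_roots hf0, IsRoot.def] at hs hsm
    refine ca_core B p hp e hv f hf0 hfn (by rw [hfdef, taylor_coeff_zero, hr])
      (by rw [hfdef, taylor_coeff, hr']) ?_ s ?_ hs hsm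
    · intro i h1 h2
      obtain ⟨x, hx, hx'⟩ := hroot i h1 h2
      refine ⟨x - r, ?_, ?_⟩
      · rw [hfdef, taylor_eval, sub_add_cancel, hx]
      · rw [hev, sub_add_cancel, hx']
    · rintro rfl
      have := hsm y hy
      simp at this
      exact hy0 this
  have hQr : ∀ x ∈ Q.roots, x = r := by
    intro x hx
    rw [mem_roots hQ0, IsRoot.def] at hx
    have := hall (x - r) (by rw [hfdef, taylor_eval, sub_add_cancel, hx])
    exact sub_eq_zero.1 this
  have hsp : Q.Splits := IsAlgClosed.splits Q
  have hrep : Q.roots = Multiset.replicate (2 * p ^ e) r := by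
    rw [Multiset.eq_replicate]
    exact ⟨by rw [← hQn, hsp.natDegree_eq_card_roots], hQr⟩
  have hQeq : Q = C (φ P.leadingCoeff) * (X - C r) ^ (2 * p ^ e) := by
    have := hsp.eq_prod_roots
    rw [hrep] at this
    simpa [Q] using this
  have hc0 : P.leadingCoeff ≠ 0 := by simpa using hP0
  have hco : φ (P.coeff (2 * p ^ e - 1)) = φ P.leadingCoeff * (-r * (2 * p ^ e : ℕ)) := by
    have := congrArg (fun t => t.coeff (2 * p ^ e - 1)) hQeq
    simp only [Q, coeff_map, coeff_C_mul, sub_eq_add_neg X, ← C_neg, coeff_X_add_C_pow] at this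
    rw [this, Nat.sub_sub_self (by omega), pow_one]
    congr 3
    rw [Nat.choose_symm (by omega), Nat.choose_one_right]
  have hn0 : ((2 * p ^ e : ℕ) : K) ≠ 0 := by
    rw [Nat.cast_ne_zero]; omega
  have hn0' : ((2 * p ^ e : ℕ) : L) ≠ 0 := by
    rw [Nat.cast_ne_zero]; omega
  have hc0' : φ P.leadingCoeff ≠ 0 := by simpa using hP0
  refine ⟨P.leadingCoeff, -(P.coeff (2 * p ^ e - 1)) / (P.leadingCoeff * (2 * p ^ e : ℕ)), ?_⟩
  have hr2 : φ (-(P.coeff (2 * p ^ e - 1)) / (P.leadingCoeff * (2 * p ^ e : ℕ))) = r := by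
    rw [map_div₀, map_neg, map_mul, map_natCast, hco, div_eq_iff (mul_ne_zero hc0' hn0')]
    ring
  apply map_injective φ hφ
  rw [Polynomial.map_mul, Polynomial.map_pow, Polynomial.map_sub, map_C, map_X, map_C, hr2]
  exact hQeq
end

section
/- Let p be a prime number with p ≠ 2, e a natural number, and K a field of characteristic 0. If P ∈ K[X] is a polynomial of degree n = 3·p^e such that for every integer i with 1 ≤ i ≤ n−1 the polynomials P and its i-th Hasse derivative are not coprime, then there exist c, r ∈ K such that P = c·(X − r)^n. -/
open Polynomial

theorem ca_hasse_map {R S : Type*} [CommRing R] [CommRing S] (f : R →+* S) (i : ℕ) (P : R[X]) :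
    hasseDeriv i (P.map f) = (hasseDeriv i P).map f := by
  ext m
  simp [hasseDeriv_coeff]

theorem ca_choose_s4 {k : Type*} [Field k] (p : ℕ) [Fact p.Prime] [CharP k p] (e a i : ℕ) :
    (((p ^ e * a).choose i : ℕ) : k) =
      if p ^ e ∣ i then ((a.choose (i / p ^ e) : ℕ) : k) else 0 := by
  have hq : 0 < p ^ e := pow_pos (Fact.out : p.Prime).pos e
  have h : ((X + 1 : k[X]) ^ (p ^ e * a)) = expand k (p ^ e) ((X + 1) ^ a) := by
    rw [pow_mul, add_pow_char_pow]
    simp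
  have h2 := congrArg (fun f => f.coeff i) h
  simp only [coeff_expand hq, coeff_X_add_one_pow] at h2
  exact h2

theorem ca_hasse_expand {k : Type*} [Field k] (p : ℕ) [Fact p.Prime] [CharP k p] (e j : ℕ)
    (Q : k[X]) : hasseDeriv (p ^ e * j) (expand k (p ^ e) Q) =
      expand k (p ^ e) (hasseDeriv j Q) := by
  have hq : 0 < p ^ e := pow_pos (Fact.out : p.Prime).pos e
  ext m
  rw [hasseDeriv_coeff, coeff_expand hq, coeff_expand hq]
  by_cases h : p ^ e ∣ m
  · obtain ⟨t, rfl⟩ := h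
    rw [← mul_add, ca_choose_s4]
    simp [hq, hasseDeriv_coeff]
  · rw [if_neg h, if_neg, mul_zero]
    rwa [← Nat.dvd_add_iff_left (dvd_mul_right _ _)]

theorem ca_charp {k : Type*} [Field k] (p : ℕ) [Fact p.Prime] [CharP k p] (hp2 : p ≠ 2) (e : ℕ)
    (R : k[X]) (hm : R.Monic) (hd : R.natDegree = 3 * p ^ e)
    (h : ∀ i : ℕ, 1 ≤ i → i ≤ 3 * p ^ e - 1 →
      ∃ x, R.eval x = 0 ∧ (hasseDeriv i R).eval x = 0)
    (h0 : R.eval 0 = 0) (h1 : R.eval 1 = 0) : False := by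
  have hq : 0 < p ^ e := pow_pos (Fact.out : p.Prime).pos e
  have key : ∀ n i : ℕ, 3 * p ^ e - i ≤ n → ¬ p ^ e ∣ i → R.coeff i = 0 := by
    intro n
    induction n with
    | zero =>
      intro i hi hdvd
      rcases (show 3 * p ^ e ≤ i by omega).lt_or_eq with h' | h'
      · exact coeff_eq_zero_of_natDegree_lt (hd ▸ h')
      · exact absurd ⟨3, by rw [← h']; ring⟩ hdvd
    | succ n ih =>
      intro i hi hdvd
      have hi1 : 1 ≤ i := by
        rcases Nat.eq_zero_or_pos i with rfl | h'
        · simp at hdvd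
        · exact h'
      by_cases hle : i ≤ 3 * p ^ e - 1
      · obtain ⟨x, -, hx⟩ := h i hi1 hle
        have hC : hasseDeriv i R = C (R.coeff i) := by
          ext m
          rw [hasseDeriv_coeff, coeff_C]
          split_ifs with hm0
          · simp [hm0]
          · by_cases hdm : p ^ e ∣ m + i
            · obtain ⟨t, ht⟩ := hdm
              rw [ht, ca_choose_s4, if_neg hdvd, zero_mul]
            · rw [ih (m + i) (by omega) hdm, mul_zero]
        simpa [hC] using hx
      · exact ih i (by omega) hdvd
  set Q : k[X] := contract (p ^ e) R with hQ
  have hRQ : R = expand k (p ^ e) Q := by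
    ext m
    rw [coeff_expand hq]
    split_ifs with hdm
    · rw [hQ, coeff_contract hq.ne', Nat.div_mul_cancel hdm]
    · exact key _ m le_rfl hdm
  have hQm : Q.Monic := by
    rw [hRQ] at hm
    exact (monic_expand_iff hq).1 hm
  have hQd : Q.natDegree = 3 := by
    rw [hRQ, natDegree_expand] at hd
    exact Nat.eq_of_mul_eq_mul_right hq hd
  have hQ3 : Q.coeff 3 = 1 := by
    have := hQm.coeff_natDegree
    rwa [hQd] at this
  have ev : ∀ y, Q.eval y = Q.coeff 0 + Q.coeff 1 * y + Q.coeff 2 * y ^ 2 + y ^ 3 := by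
    intro y
    rw [eval_eq_sum_range, hQd]
    simp [Finset.sum_range_succ, hQ3]
  have hq3 : Q.coeff 4 = 0 := coeff_eq_zero_of_natDegree_lt (by omega)
  have ev1 : ∀ y, (hasseDeriv 1 Q).eval y = Q.coeff 1 + 2 * Q.coeff 2 * y + 3 * y ^ 2 := by
    intro y
    rw [eval_eq_sum_range' (n := 3) (lt_of_le_of_lt (natDegree_hasseDeriv_le Q 1) (by omega))]
    simp [Finset.sum_range_succ, hQ3, coeff_derivative]
    ring
  have ev2 : ∀ y, (hasseDeriv 2 Q).eval y = Q.coeff 2 + 3 * y := by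
    intro y
    rw [eval_eq_sum_range' (n := 2) (lt_of_le_of_lt (natDegree_hasseDeriv_le Q 2) (by omega))]
    simp [Finset.sum_range_succ, hQ3, hasseDeriv_coeff]
  have ex : ∀ j, 1 ≤ j → j ≤ 2 → ∃ y, Q.eval y = 0 ∧ (hasseDeriv j Q).eval y = 0 := by
    intro j hj1 hj2
    obtain ⟨x, hx, hx'⟩ := h (p ^ e * j) (Nat.mul_pos hq hj1) (by
      have : p ^ e * j ≤ p ^ e * 2 := Nat.mul_le_mul_left _ hj2
      omega)
    rw [hRQ] at hx hx'
    rw [ca_hasse_expand, expand_eval] at hx'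
    rw [expand_eval] at hx
    exact ⟨_, hx, hx'⟩
  obtain ⟨s, hs, hs'⟩ := ex 2 (by norm_num) le_rfl
  obtain ⟨t, ht, ht'⟩ := ex 1 le_rfl (by norm_num)
  rw [ev2] at hs'
  rw [ev1] at ht'
  rw [ev] at hs ht
  rw [hRQ, expand_eval, ev] at h0 h1
  rw [zero_pow hq.ne'] at h0
  rw [one_pow] at h1
  have two : (2 : k) ≠ 0 := by
    intro h2
    have : p ∣ 2 := (CharP.cast_eq_zero_iff k p 2).1 (by exact_mod_cast h2)
    exact hp2 ((Nat.prime_dvd_prime_iff_eq Fact.out Nat.prime_two).1 this)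
  generalize Q.coeff 0 = c at *
  generalize Q.coeff 1 = b at *
  generalize Q.coeff 2 = a at *
  have ha : a = -3 * s := by linear_combination hs'
  subst ha
  have hb : b = 6 * s * t - 3 * t ^ 2 := by linear_combination ht'
  subst hb
  have hc : c = 0 := by linear_combination h0
  subst hc
  have hst : 2 * (t - s) ^ 3 = 0 := by linear_combination hs - ht
  have hts : t = s := by
    have := (mul_eq_zero.1 hst).resolve_left two
    exact sub_eq_zero.1 (pow_eq_zero_iff (by norm_num) |>.1 this)
  subst hts
  have ht0 : t = 0 := by
    have : t ^ 3 = 0 := by linear_combination hs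
    exact pow_eq_zero_iff (by norm_num) |>.1 this
  subst ht0
  simp at h1

theorem ca_affine {L : Type*} [Field L] (P : L[X]) (d r x : L) (i : ℕ) :
    (hasseDeriv i (P.comp (C d * X + C r))).eval x =
      (hasseDeriv i P).eval (d * x + r) * d ^ i := by
  rw [← taylor_coeff, ← taylor_coeff, ← comp_C_mul_X_coeff]
  congr 1
  simp only [taylor_apply, comp_assoc]
  congr 1
  simp
  ring

theorem ca_val (L : Type*) [Field L] [CharZero L] (p : ℕ) (hp : p.Prime) :
    ∃ A : ValuationSubring L, CharP (IsLocalRing.ResidueField A) p := by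
  let S : Subring L := (Int.castRingHom L).range
  have hne : Ideal.span {(p : S)} ≠ ⊤ := by
    rw [Ne, Ideal.span_singleton_eq_top]
    intro hu
    obtain ⟨⟨y, m, rfl⟩, hy⟩ := hu.exists_right_inv
    have h2 := congrArg (fun z : S => (z : L)) hy
    simp only [Subring.coe_mul, Subring.coe_natCast, Subring.coe_one, eq_intCast] at h2
    have h3 : (p : ℤ) * m = 1 := by exact_mod_cast h2
    have h4 : (p : ℤ) ∣ 1 := ⟨m, h3.symm⟩
    exact hp.one_lt.ne' (by exact_mod_cast Int.eq_one_of_dvd_one (by positivity) h4)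
  obtain ⟨A, -, hA⟩ := Ideal.image_subset_nonunits_valuationSubring _ hne
  refine ⟨A, ?_⟩
  have hmem : ((p : A) : L) ∈ A.nonunits := by
    apply hA
    exact ⟨(p : S), Ideal.subset_span rfl, by simp⟩
  rw [ValuationSubring.coe_mem_nonunits_iff] at hmem
  have h0 : ((p : ℕ) : IsLocalRing.ResidueField A) = 0 := by
    have := (IsLocalRing.residue_eq_zero_iff (p : A)).2 hmem
    simpa using this
  refine ⟨fun x => ⟨fun hx => ?_, ?_⟩⟩
  · by_contra hnd
    have hcop : Nat.Coprime p x := (Nat.Prime.coprime_iff_not_dvd hp).2 hnd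
    have h1 := congrArg (Int.cast : ℤ → IsLocalRing.ResidueField A) (Nat.gcd_eq_gcd_ab p x)
    rw [Nat.Coprime.gcd_eq_one hcop] at h1
    push_cast at h1
    rw [h0, hx] at h1
    simp at h1
  · rintro ⟨t, rfl⟩
    rw [Nat.cast_mul, h0, zero_mul]

theorem ca_closed (p : ℕ) (hp : p.Prime) (hp2 : p ≠ 2) (e : ℕ) (L : Type*) [Field L] [CharZero L]
    [IsAlgClosed L] (P : L[X]) (hm : P.Monic) (hd : P.natDegree = 3 * p ^ e)
    (h : ∀ i : ℕ, 1 ≤ i → i ≤ 3 * p ^ e - 1 →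
      ∃ x, P.eval x = 0 ∧ (hasseDeriv i P).eval x = 0) (r s' : L) (hr : P.eval r = 0)
      (hs' : P.eval s' = 0) : s' = r := by
  have : Fact p.Prime := ⟨hp⟩
  by_contra hne
  classical
  obtain ⟨A, hA⟩ := ca_val L p hp
  obtain ⟨s, hs, hmax⟩ := P.roots.toFinset.exists_max_image (fun t => A.valuation (t - r))
    ⟨s', by simp [hm.ne_zero, hs']⟩
  simp only [Multiset.mem_toFinset, mem_roots hm.ne_zero, IsRoot.def] at hs hmax
  set d := s - r with hdd
  have hd0 : d ≠ 0 := by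
    intro h0
    have := hmax s' hs'
    rw [h0, map_zero, le_zero_iff, map_eq_zero] at this
    exact hne (sub_eq_zero.1 this)
  have hdn : d ^ (3 * p ^ e) ≠ 0 := pow_ne_zero _ hd0
  have hlin : (C d * X + C r).natDegree = 1 := natDegree_linear hd0
  set Q := C (d ^ (3 * p ^ e))⁻¹ * P.comp (C d * X + C r) with hQ
  have hQev : ∀ x, Q.eval x = 0 ↔ P.eval (d * x + r) = 0 := by
    intro x
    simp [hQ, hd0, hp.ne_zero]
  have hQd : Q.natDegree = 3 * p ^ e := by
    rw [hQ, natDegree_C_mul (inv_ne_zero hdn), natDegree_comp, hlin, hd, mul_one]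
  have hQm : Q.Monic := by
    rw [Monic, hQ, leadingCoeff_mul, leadingCoeff_C, leadingCoeff_comp (by rw [hlin]; norm_num),
      leadingCoeff_linear hd0, hm.leadingCoeff, one_mul, hd, inv_mul_cancel₀ hdn]
  have hQr : ∀ x, Q.eval x = 0 → x ∈ A := by
    intro x hx
    have := hmax _ ((hQev x).1 hx)
    rw [add_sub_cancel_right, map_mul] at this
    rw [← A.valuation_le_one_iff]
    exact le_of_mul_le_mul_left (by simpa using this) (by simpa [zero_lt_iff] using hd0)
  have hQl : Q ∈ lifts (algebraMap A L) := by
    rw [(IsAlgClosed.splits Q).eq_prod_roots_of_monic hQm]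
    refine Subsemiring.multiset_prod_mem _ _ ?_
    intro f hf
    obtain ⟨t, ht, rfl⟩ := Multiset.mem_map.1 hf
    have htA := hQr t (isRoot_of_mem_roots ht)
    exact ⟨X - C ⟨t, htA⟩, by simp⟩
  obtain ⟨R, hRQ, hRd, hRm⟩ := lifts_and_natDegree_eq_and_monic hQl hQm
  have evR : ∀ (F : A[X]) (a : A), (F.map (algebraMap A L)).eval (a : L) = 0 →
      (F.map (IsLocalRing.residue A)).eval (IsLocalRing.residue A a) = 0 := by
    intro F a hF
    have : (F.map (algebraMap A L)).eval (algebraMap A L a) = 0 := hF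
    rw [eval_map_apply] at this
    rw [eval_map_apply, (FaithfulSMul.algebraMap_injective A L) (this.trans (map_zero _).symm), map_zero]
  refine ca_charp (k := IsLocalRing.ResidueField A) p hp2 e (R.map (IsLocalRing.residue A))
    (hRm.map _) ?_ ?_ ?_ ?_
  · rw [hRm.natDegree_map, hRd, hQd]
  · intro i hi1 hi2
    obtain ⟨x, hx, hx'⟩ := h i hi1 hi2
    have hxx : d * ((x - r) / d) + r = x := by field_simp; ring
    have hy : Q.eval ((x - r) / d) = 0 := by rw [hQev, hxx, hx]
    refine ⟨IsLocalRing.residue A ⟨_, hQr _ hy⟩, evR _ _ ?_, ?_⟩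
    · rw [hRQ]; exact hy
    · rw [ca_hasse_map]
      apply evR
      rw [← ca_hasse_map, hRQ, hQ, ← smul_eq_C_mul, map_smul, eval_smul]
      simp only [ca_affine, hxx, hx', zero_mul, smul_zero]
  · have := evR R 0 (by rw [hRQ]; simpa [hQev] using hr)
    simpa using this
  · have := evR R 1 (by rw [hRQ]; simpa [hQev, hdd] using hs)
    simpa using this

theorem casas_alvero_deg_3pe (p : ℕ) (hp : p.Prime) (hp2 : p ≠ 2)
    (e : ℕ) (K : Type*) [Field K] [CharZero K]
    (P : K[X]) (hdeg : P.degree = (3 * p ^ e : ℕ))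
    (hcop : ∀ i : ℕ, 1 ≤ i → i ≤ 3 * p ^ e - 1 → ¬ IsCoprime P (hasseDeriv i P)) :
    ∃ c r : K, P = C c * (X - C r) ^ (3 * p ^ e) := by
  have hnd : P.natDegree = 3 * p ^ e := natDegree_eq_of_degree_eq_some hdeg
  have hn0 : 3 * p ^ e ≠ 0 := by have := hp.ne_zero; positivity
  have hP0 : P ≠ 0 := by rintro rfl; exact hn0 (by simpa using hnd.symm)
  have hlc : P.leadingCoeff ≠ 0 := leadingCoeff_ne_zero.2 hP0
  let L := AlgebraicClosure K
  have : CharZero L := charZero_of_injective_algebraMap (algebraMap K L).injective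
  set M : K[X] := C P.leadingCoeff⁻¹ * P with hM
  have hPM : P = C P.leadingCoeff * M := by
    rw [hM, ← mul_assoc, ← C_mul, mul_inv_cancel₀ hlc, C_1, one_mul]
  have hMm : M.Monic := by
    rw [Monic, hM, leadingCoeff_mul, leadingCoeff_C, inv_mul_cancel₀ hlc]
  have hMd : M.natDegree = 3 * p ^ e := by
    rw [hM, natDegree_C_mul (inv_ne_zero hlc), hnd]
  set N : L[X] := M.map (algebraMap K L) with hN
  have hNm : N.Monic := hMm.map _
  have hNd : N.natDegree = 3 * p ^ e := by rw [hN, hMm.natDegree_map, hMd]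
  have hcl := ca_closed p hp hp2 e L N hNm hNd (by
    intro i hi1 hi2
    have := hcop i hi1 hi2
    rw [isCoprime_iff_aeval_ne_zero_of_isAlgClosed (k := K) (K := L)] at this
    push Not at this
    obtain ⟨x, hx, hx'⟩ := this
    refine ⟨x, ?_, ?_⟩
    · rw [hN, eval_map_algebraMap, hM, map_mul, hx, mul_zero]
    · rw [hN, ca_hasse_map, eval_map_algebraMap, hM, ← smul_eq_C_mul, map_smul, map_smul, hx',
        smul_zero])
  obtain ⟨r, hr⟩ := IsAlgClosed.exists_root N (by
    rw [degree_eq_natDegree hNm.ne_zero, hNd]; exact_mod_cast hn0)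
  have hroots : N.roots = Multiset.replicate (3 * p ^ e) r := by
    rw [Multiset.eq_replicate]
    refine ⟨?_, fun b hb => hcl r b hr (isRoot_of_mem_roots hb)⟩
    rw [← hNd]
    exact (IsAlgClosed.splits N).natDegree_eq_card_roots.symm
  have hNe : N = (X - C r) ^ (3 * p ^ e) := by
    rw [(IsAlgClosed.splits N).eq_prod_roots_of_monic hNm, hroots]
    simp
  have hco : (algebraMap K L) M.nextCoeff = - ((3 * p ^ e : ℕ) : L) * r := by
    rw [← nextCoeff_map (algebraMap K L).injective, ← hN, hNe, (monic_X_sub_C r).nextCoeff_pow,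
      nextCoeff_X_sub_C]
    simp
    ring
  have hnL : ((3 * p ^ e : ℕ) : L) ≠ 0 := by exact_mod_cast hn0
  have hrK : algebraMap K L (- M.nextCoeff / ((3 * p ^ e : ℕ) : K)) = r := by
    rw [map_div₀, map_neg, hco, map_natCast]
    rw [neg_mul, neg_neg, mul_div_cancel_left₀ _ hnL]
  refine ⟨P.leadingCoeff, - M.nextCoeff / ((3 * p ^ e : ℕ) : K), ?_⟩
  conv_lhs => rw [hPM]
  congr 1
  apply map_injective _ (algebraMap K L).injective
  rw [← hN, hNe, Polynomial.map_pow, Polynomial.map_sub, map_X, map_C, hrK]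
end

section
/- Let p be a prime number with p ∉ {2, 3}, and let K be an algebraically closed field of characteristic p. If P ∈ K[X] is a polynomial of degree 3 such that for every integer i with 1 ≤ i ≤ 2 the polynomials P and its i-th Hasse derivative are not coprime, then there exist c, r ∈ K such that P = c·(X − r)^3. -/
open Polynomial

theorem casas_alvero_deg3_charp (p : ℕ) (hp : p.Prime)
    (hp' : p ∉ ({2, 3} : Finset ℕ))
    (K : Type*) [Field K] [IsAlgClosed K] [CharP K p]
    (P : K[X]) (hdeg : P.degree = 3)
    (hcop : ∀ i : ℕ, 1 ≤ i → i ≤ 2 → ¬ IsCoprime P (hasseDeriv i P)) :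
    ∃ c r : K, P = C c * (X - C r) ^ 3 := by
  have h2 : (2 : K) ≠ 0 := by
    intro h
    have h' : ((2 : ℕ) : K) = 0 := by exact_mod_cast h
    rw [CharP.cast_eq_zero_iff K p] at h'
    have := (Nat.prime_dvd_prime_iff_eq hp Nat.prime_two).1 h'
    simp [this] at hp'
  have hnd : P.natDegree = 3 := natDegree_eq_of_degree_eq_some hdeg
  have ha : P.coeff 3 ≠ 0 := by
    rw [← hnd]
    have : P ≠ 0 := by rintro rfl; simp at hnd
    simpa using this
  have root : ∀ Q : K[X], ¬ IsCoprime P Q → ∃ x, P.eval x = 0 ∧ Q.eval x = 0 := by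
    intro Q hQ
    by_contra hcon
    push Not at hcon
    apply hQ
    rw [isCoprime_iff_aeval_ne_zero_of_isAlgClosed K K]
    intro x
    simp only [coe_aeval_eq_eval]
    by_cases h : P.eval x = 0
    · exact Or.inr (hcon x h)
    · exact Or.inl h
  obtain ⟨s, hs0, hs1⟩ := root _ (hcop 1 le_rfl (by norm_num))
  obtain ⟨r, hr0, hr1⟩ := root _ (hcop 2 (by norm_num) le_rfl)
  have hP : P = C (P.coeff 0) + C (P.coeff 1) * X + C (P.coeff 2) * X ^ 2
      + C (P.coeff 3) * X ^ 3 := by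
    conv_lhs => rw [P.as_sum_range_C_mul_X_pow, hnd]
    simp [Finset.sum_range_succ]
  generalize P.coeff 0 = d at *
  generalize P.coeff 1 = c at *
  generalize P.coeff 2 = b at *
  generalize P.coeff 3 = a at *
  subst hP
  have e2 : hasseDeriv 2 (C d + C c * X + C b * X ^ 2 + C a * X ^ 3) = C b + C (3 * a) * X := by
    simp only [map_add, C_mul_X_pow_eq_monomial, C_mul_X_eq_monomial, hasseDeriv_monomial,
      hasseDeriv_C _ _ two_pos]
    norm_num [Nat.choose]
  rw [e2] at hr1
  rw [hasseDeriv_one'] at hs1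
  simp at hs0 hs1 hr0 hr1
  have ht : s = r := by
    have : 2 * a * (s - r) ^ 3 = 0 := by grind
    have := pow_eq_zero_iff (three_ne_zero) |>.1 ((mul_eq_zero.1 this).resolve_left (mul_ne_zero h2 ha))
    exact sub_eq_zero.1 this
  subst ht
  have hb : b = -3 * a * s := by grind
  have hc : c = 3 * a * s ^ 2 := by grind
  have hd : d = - a * s ^ 3 := by grind
  refine ⟨a, s, ?_⟩
  rw [hb, hc, hd]
  simp only [map_mul, map_neg, map_pow, map_ofNat]
  ring
end

section
/- Let p be a prime number with p ∉ {2, 3, 5, 7}, and let K be an algebraically closed field of characteristic p. If P ∈ K[X] is a polynomial of degree 4 such that for every integer i with 1 ≤ i ≤ 3 the polynomials P and its i-th Hasse derivative are not coprime, then there exist c, r ∈ K such that P = c·(X − r)^4. -/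
open Polynomial

theorem ca4_core {K : Type*} [Field K] (h2 : (2:K) ≠ 0) (h3 : (3:K) ≠ 0) (h5 : (5:K) ≠ 0)
    (h7 : (7:K) ≠ 0) (b c s t : K)
    (hs : s ^ 4 + b * s ^ 2 + c * s = 0) (hs2 : 6 * s ^ 2 + b = 0)
    (ht : t ^ 4 + b * t ^ 2 + c * t = 0) (ht1 : 4 * t ^ 3 + 2 * b * t + c = 0) :
    b = 0 ∧ c = 0 := by
  have hb : b = -6 * s ^ 2 := by linear_combination hs2
  subst hb
  by_cases hs0 : s = 0
  · subst hs0
    refine ⟨by ring, ?_⟩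
    have : 3 * t ^ 4 = 0 := by linear_combination t * ht1 - ht
    have ht0 : t = 0 := by simpa [h3] using this
    subst ht0
    linear_combination ht1
  · exfalso
    have hc : c = 5 * s ^ 3 := by
      apply mul_left_cancel₀ hs0
      linear_combination hs
    subst hc
    have ht0 : t ≠ 0 := by
      rintro rfl
      have : 5 * s ^ 3 = 0 := by linear_combination ht1
      simp [h5, hs0] at this
    have e1 : t ^ 3 - 6 * s ^ 2 * t + 5 * s ^ 3 = 0 := by
      apply mul_left_cancel₀ ht0
      linear_combination ht
    have e2 : t ^ 2 = 2 * s ^ 2 := by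
      apply mul_left_cancel₀ (mul_ne_zero h3 ht0)
      linear_combination ht1 - e1
    have e3 : 5 * s = 4 * t := by
      apply mul_left_cancel₀ (pow_ne_zero 2 hs0)
      linear_combination e1 - t * e2
    have e4 : 7 * s ^ 2 = 0 := by
      linear_combination (-(5 * s + 4 * t)) * e3 - 16 * e2
    simp [h7, hs0] at e4

theorem casas_alvero_deg4_charp (p : ℕ) (hp : p.Prime)
    (hp' : p ∉ ({2, 3, 5, 7} : Finset ℕ))
    (K : Type*) [Field K] [IsAlgClosed K] [CharP K p]
    (P : K[X]) (hdeg : P.degree = 4)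
    (hcop : ∀ i : ℕ, 1 ≤ i → i ≤ 3 → ¬ IsCoprime P (hasseDeriv i P)) :
    ∃ c r : K, P = C c * (X - C r) ^ 4 := by
  have hne : ∀ q : ℕ, q.Prime → q ∈ ({2, 3, 5, 7} : Finset ℕ) → (q : K) ≠ 0 := by
    intro q hq hm h
    rw [CharP.cast_eq_zero_iff K p, Nat.prime_dvd_prime_iff_eq hp hq] at h
    exact hp' (h ▸ hm)
  have h2 : (2:K) ≠ 0 := by exact_mod_cast hne 2 (by norm_num) (by simp)
  have h3 : (3:K) ≠ 0 := by exact_mod_cast hne 3 (by norm_num) (by simp)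
  have h5 : (5:K) ≠ 0 := by exact_mod_cast hne 5 (by norm_num) (by simp)
  have h7 : (7:K) ≠ 0 := by exact_mod_cast hne 7 (by norm_num) (by simp)
  have hroot : ∀ i : ℕ, 1 ≤ i → i ≤ 3 → ∃ x, P.eval x = 0 ∧ (hasseDeriv i P).eval x = 0 := by
    intro i h1 h3
    by_contra! h
    apply hcop i h1 h3
    rw [isCoprime_iff_aeval_ne_zero_of_isAlgClosed K K]
    intro x
    by_cases hx : P.eval x = 0
    · right; simpa using h x hx
    · left; simpa using hx
  have hnat : P.natDegree = 4 := natDegree_eq_of_degree_eq_some hdeg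
  have ha : P.coeff 4 ≠ 0 := by
    rw [← hnat]; exact leadingCoeff_ne_zero.2 (by rintro rfl; simp at hnat)
  obtain ⟨r, hr, hr3⟩ := hroot 3 (by norm_num) (by norm_num)
  obtain ⟨s, hs, hs2⟩ := hroot 2 (by norm_num) (by norm_num)
  obtain ⟨t, ht, ht1⟩ := hroot 1 (by norm_num) (by norm_num)
  have hP := P.as_sum_range' 5 (by omega)
  simp only [Finset.sum_range_succ, Finset.sum_range_zero, zero_add] at hP
  generalize P.coeff 0 = a0 at *
  generalize P.coeff 1 = a1 at *
  generalize P.coeff 2 = a2 at *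
  generalize P.coeff 3 = a3 at *
  generalize P.coeff 4 = a at *
  clear hdeg hcop hroot hnat
  subst hP
  simp [hasseDeriv_C, hasseDeriv_monomial, eval_monomial, Nat.choose] at hr hr3 hs hs2 ht ht1
  have h3' : a3 = -4 * a * r := by linear_combination hr3
  subst h3'
  have h0 : a0 = -(a1 * r + a2 * r ^ 2 + -4 * a * r * r ^ 3 + a * r ^ 4) := by
    linear_combination hr
  subst h0
  obtain ⟨B, hB⟩ : ∃ B, a2 = a * (B + 6 * r ^ 2) := ⟨a2 / a - 6 * r ^ 2, by field_simp; ring⟩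
  subst hB
  obtain ⟨D, hD⟩ : ∃ D, a1 = a * (D - 2 * B * r - 4 * r ^ 3) :=
    ⟨a1 / a + 2 * B * r + 4 * r ^ 3, by field_simp; ring⟩
  subst hD
  obtain ⟨rfl, rfl⟩ := ca4_core h2 h3 h5 h7 B D (s - r) (t - r)
    (by apply mul_left_cancel₀ ha; linear_combination hs)
    (by apply mul_left_cancel₀ ha; linear_combination hs2)
    (by apply mul_left_cancel₀ ha; linear_combination ht)
    (by apply mul_left_cancel₀ ha; linear_combination ht1)
  refine ⟨a, r, ?_⟩
  simp only [← C_mul_X_pow_eq_monomial]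
  simp only [map_add, map_sub, map_mul, map_neg, map_pow, map_ofNat, map_zero]
  ring
end

section
/- Let n ≥ 1 be an integer. Suppose that for every field K of characteristic 0, every polynomial P ∈ K[X] of degree n that is not coprime with each of its first n−1 Hasse derivatives is of the form c·(X − r)^n. Then there exists a finite set S of prime numbers such that for every prime p ∉ S, every polynomial P of degree n over the algebraic closure of 𝔽_p that is not coprime with each of its first n−1 Hasse derivatives is of the form c·(X − r)^n. -/
open Polynomial

theorem casas_hasseDeriv_map {R S : Type*} [CommRing R] [CommRing S] (f : R →+* S) (i : ℕ)
    (Q : R[X]) : hasseDeriv i (Q.map f) = (hasseDeriv i Q).map f := by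
  ext j
  simp [hasseDeriv_coeff]

theorem casas_aux (n : ℕ)
    (H : ∀ (K : Type) [Field K] [CharZero K] (P : K[X]), P.degree = n →
      (∀ i : ℕ, 1 ≤ i → i ≤ n - 1 → ¬ IsCoprime P (hasseDeriv i P)) →
      ∃ c r : K, P = C c * (X - C r) ^ n)
    (ι : Type) [Infinite ι] (F : ι → Type) [∀ p, Field (F p)]
    (hchar : ∀ m : ℕ, m ≠ 0 → {p : ι | (m : F p) = 0}.Finite)
    (P : ∀ p, (F p)[X]) (hdeg : ∀ p, (P p).degree = n)
    (hroot : ∀ i : ℕ, 1 ≤ i → i ≤ n - 1 → ∀ p, ∃ a : F p,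
      (P p).eval a = 0 ∧ (hasseDeriv i (P p)).eval a = 0) :
    ∃ (p : ι) (c r : F p), P p = C c * (X - C r) ^ n := by
  classical
  by_contra hcon
  push Not at hcon
  let I : Ideal (∀ p, F p) :=
    { carrier := {f | {p | f p ≠ 0}.Finite}
      add_mem' := by
        intro a b ha hb
        refine (ha.union hb).subset ?_
        intro p hp
        by_contra h
        simp only [Set.mem_union, Set.mem_setOf_eq, not_or, not_not] at h
        exact hp (by simp [h.1, h.2])
      zero_mem' := by simp
      smul_mem' := by
        intro c x hx
        refine Set.Finite.subset hx ?_
        intro p hp h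
        exact hp (by simp [h]) }
  have hI : I ≠ ⊤ := by
    intro h
    have h1 : (1 : ∀ p, F p) ∈ I := by rw [h]; trivial
    have h2 : {p : ι | (1 : ∀ p, F p) p ≠ 0}.Finite := h1
    simp only [Pi.one_apply, ne_eq, one_ne_zero, not_false_eq_true, Set.setOf_true] at h2
    exact Set.infinite_univ h2
  obtain ⟨M, hM, hIM⟩ := Ideal.exists_le_maximal I hI
  letI : Field ((∀ p, F p) ⧸ M) := Ideal.Quotient.field M
  let φ : (∀ p, F p) →+* ((∀ p, F p) ⧸ M) := Ideal.Quotient.mk M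
  have hφ : ∀ x, φ x = 0 ↔ x ∈ M := fun x => Ideal.Quotient.eq_zero_iff_mem
  have hsurj : Function.Surjective φ := Ideal.Quotient.mk_surjective
  have h1M : (1 : ∀ p, F p) ∉ M := fun h => hM.ne_top ((Ideal.eq_top_iff_one M).2 h)
  haveI : CharZero ((∀ p, F p) ⧸ M) := by
    apply charZero_of_inj_zero
    intro m hm
    by_contra hm0
    have hmM : (m : ∀ p, F p) ∈ M := by rw [← hφ, map_natCast]; exact hm
    let g : ∀ p, F p := fun p => (m : F p)⁻¹
    have h1 : 1 - g * (m : ∀ p, F p) ∈ M := by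
      apply hIM
      refine Set.Finite.subset (hchar m hm0) ?_
      intro p hp
      by_contra h
      apply hp
      simp only [Set.mem_setOf_eq] at h
      simp [g, h]
    apply h1M
    have := M.add_mem h1 (M.mul_mem_left g hmM)
    simpa using this
  let Q : (∀ p, F p)[X] := ∑ j ∈ Finset.range (n + 1), C (fun p => (P p).coeff j) * X ^ j
  have hQ : ∀ p, Q.map (Pi.evalRingHom F p) = P p := by
    intro p
    have hn : (P p).natDegree = n := natDegree_eq_of_degree_eq_some (hdeg p)
    conv_rhs => rw [(P p).as_sum_range_C_mul_X_pow, hn]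
    simp [Q, Polynomial.map_sum]
  have hQdeg : Q.natDegree ≤ n := by
    apply natDegree_sum_le_of_forall_le
    intro j hj
    refine (natDegree_C_mul_X_pow_le _ _).trans ?_
    have := Finset.mem_range.1 hj
    omega
  have hcoe : ∀ (D : (∀ p, F p)[X]) j p, (D.map (Pi.evalRingHom F p)).coeff j = D.coeff j p := by
    intro D j p
    rw [coeff_map]; rfl
  have hQn : ∀ p, Q.coeff n p ≠ 0 := by
    intro p
    rw [← hcoe, hQ]
    have hn : (P p).natDegree = n := natDegree_eq_of_degree_eq_some (hdeg p)
    have hp0 : P p ≠ 0 := by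
      intro h
      have := hdeg p
      simp [h] at this
    rw [← hn]
    exact leadingCoeff_ne_zero.2 hp0
  have hd : (Q.map φ).degree = n := by
    apply le_antisymm
    · exact degree_map_le.trans (natDegree_le_iff_degree_le.1 hQdeg)
    · apply le_degree_of_ne_zero
      rw [coeff_map, Ne, hφ]
      intro h
      apply h1M
      have := M.mul_mem_left (fun p => (Q.coeff n p)⁻¹) h
      convert this using 1
      funext p
      simp [hQn p]
  have hev : ∀ (D : (∀ p, F p)[X]) (a : ∀ p, F p),
      (∀ p, (D.map (Pi.evalRingHom F p)).eval (a p) = 0) → (D.map φ).eval (φ a) = 0 := by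
    intro D a h
    have : D.eval a = 0 := by
      funext p
      have h2 := h p
      have h3 := Polynomial.eval_map_apply (f := Pi.evalRingHom F p) (p := D) a
      simp only [Pi.evalRingHom_apply] at h3
      rw [Pi.zero_apply, ← h3]
      exact h2
    rw [Polynomial.eval_map_apply, this, map_zero]
  obtain ⟨c, r, hcr⟩ := H _ (Q.map φ) hd (by
    intro i h1 h2 hcop
    choose a ha using hroot i h1 h2
    obtain ⟨u, v, huv⟩ := hcop
    have e1 := hev Q a (fun p => by rw [hQ]; exact (ha p).1)
    have e2 := hev (hasseDeriv i Q) a (fun p => by rw [← casas_hasseDeriv_map, hQ]; exact (ha p).2)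
    rw [← casas_hasseDeriv_map] at e2
    have := congrArg (eval (φ a)) huv
    simp [e1, e2] at this)
  obtain ⟨c, rfl⟩ := hsurj c
  obtain ⟨r, rfl⟩ := hsurj r
  let D := Q - C c * (X - C r) ^ n
  have hD : D.map φ = 0 := by
    simp only [D, Polynomial.map_sub, Polynomial.map_mul, Polynomial.map_pow, map_X, map_C]
    rw [← hcr, sub_self]
  have hDM : ∀ j, D.coeff j ∈ M := by
    intro j
    rw [← hφ, ← coeff_map, hD, coeff_zero]
  have hne : ∀ p, ∃ j, D.coeff j p ≠ 0 := by
    intro p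
    by_contra h
    push Not at h
    apply hcon p (c p) (r p)
    have : D.map (Pi.evalRingHom F p) = 0 := by
      ext j
      rw [hcoe, h, coeff_zero]
    simp only [D, Polynomial.map_sub, Polynomial.map_mul, Polynomial.map_pow, map_X, map_C, hQ]
      at this
    exact sub_eq_zero.1 this
  choose j hj using hne
  have hjs : ∀ p, j p ∈ D.support := by
    intro p
    rw [mem_support_iff]
    intro h
    exact hj p (by rw [h]; rfl)
  apply h1M
  have : (1 : ∀ p, F p) = ∑ k ∈ D.support,
      (fun p => if j p = k then (D.coeff k p)⁻¹ else 0) * D.coeff k := by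
    funext p
    rw [Finset.sum_apply, Finset.sum_eq_single (j p)]
    · simp [hj p]
    · intro b _ hb
      simp [Ne.symm hb]
    · intro h
      exact absurd (hjs p) h
  rw [this]
  exact M.sum_mem fun k _ => M.mul_mem_left _ (hDM k)

theorem casas_alvero_char0_to_charp (n : ℕ) (hn : 1 ≤ n)
    (H : ∀ (K : Type) [Field K] [CharZero K] (P : K[X]), P.degree = n →
      (∀ i : ℕ, 1 ≤ i → i ≤ n - 1 → ¬ IsCoprime P (hasseDeriv i P)) →
      ∃ c r : K, P = C c * (X - C r) ^ n) :
    ∃ S : Finset ℕ, ∀ (p : ℕ) [Fact p.Prime], p ∉ S →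
      ∀ P : Polynomial (AlgebraicClosure (ZMod p)), P.degree = n →
        (∀ i : ℕ, 1 ≤ i → i ≤ n - 1 → ¬ IsCoprime P (hasseDeriv i P)) →
        ∃ c r : AlgebraicClosure (ZMod p), P = C c * (X - C r) ^ n := by
  classical
  let B : Set ℕ := {p | ∃ _ : Fact p.Prime, ∃ P : Polynomial (AlgebraicClosure (ZMod p)),
    P.degree = n ∧ (∀ i : ℕ, 1 ≤ i → i ≤ n - 1 → ¬ IsCoprime P (hasseDeriv i P)) ∧
    ¬ ∃ c r : AlgebraicClosure (ZMod p), P = C c * (X - C r) ^ n}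
  by_cases hB : B.Finite
  · refine ⟨hB.toFinset, ?_⟩
    intro p hp hpS P h1 h2
    by_contra h3
    exact hpS (hB.mem_toFinset.2 ⟨hp, P, h1, h2, h3⟩)
  · exfalso
    haveI : Infinite B := Set.infinite_coe_iff.2 hB
    haveI hpr : ∀ p : B, Fact (p : ℕ).Prime := fun p => p.2.choose
    have hP : ∀ p : B, ∃ P : Polynomial (AlgebraicClosure (ZMod (p : ℕ))),
      P.degree = n ∧ (∀ i : ℕ, 1 ≤ i → i ≤ n - 1 → ¬ IsCoprime P (hasseDeriv i P)) ∧
      ¬ ∃ c r : AlgebraicClosure (ZMod (p : ℕ)), P = C c * (X - C r) ^ n :=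
      fun p => p.2.choose_spec
    choose P h1 h2 h3 using hP
    obtain ⟨p, c, r, h⟩ := casas_aux n H B (fun p => AlgebraicClosure (ZMod (p : ℕ)))
      (by
        intro m hm
        have : {p : B | (p : ℕ) ∣ m}.Finite := by
          refine Set.Finite.of_finite_image (f := Subtype.val) ?_ Subtype.val_injective.injOn
          refine (Set.finite_Iic m).subset ?_
          rintro _ ⟨p, hp, rfl⟩
          exact Nat.le_of_dvd (Nat.pos_of_ne_zero hm) hp
        refine this.subset ?_
        intro p hp
        haveI : CharP (AlgebraicClosure (ZMod (p : ℕ))) (p : ℕ) :=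
          charP_of_injective_algebraMap
            (algebraMap (ZMod (p : ℕ)) (AlgebraicClosure (ZMod (p : ℕ)))).injective _
        exact (CharP.cast_eq_zero_iff (AlgebraicClosure (ZMod (p : ℕ))) (p : ℕ) m).1 hp)
      P h1 (by
        intro i hi hi' p
        by_contra hc
        apply h2 p i hi hi'
        rw [Polynomial.isCoprime_iff_aeval_ne_zero_of_isAlgClosed
          (AlgebraicClosure (ZMod (p : ℕ))) (AlgebraicClosure (ZMod (p : ℕ)))]
        intro a
        by_contra hh
        push Not at hh
        exact hc ⟨a, by simpa [coe_aeval_eq_eval] using hh⟩)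
    exact h3 p ⟨c, r, h⟩
end

section
/- Let p be a prime number and let P = X^{p+1} − X^p ∈ (ZMod p)[X]. Then for every integer i with 1 ≤ i ≤ p, the polynomials P and its i-th Hasse derivative are not coprime, yet there exist no c, r ∈ ZMod p (nor in any field extension) with P = c·(X − r)^{p+1}; in particular P is a counterexample to the Casas-Alvero statement in characteristic p. -/
open Polynomial

theorem casas_alvero_counterexample_charp (p : ℕ) [Fact p.Prime] :
    (∀ i : ℕ, 1 ≤ i → i ≤ p →
      ¬ IsCoprime (X ^ (p + 1) - X ^ p : (ZMod p)[X])
        (hasseDeriv i (X ^ (p + 1) - X ^ p : (ZMod p)[X]))) ∧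
    (∀ (L : Type*) [Field L] (f : ZMod p →+* L),
      ¬ ∃ c r : L, Polynomial.map f (X ^ (p + 1) - X ^ p) = C c * (X - C r) ^ (p + 1)) := by
  have hp0 : p ≠ 0 := (Fact.out : p.Prime).ne_zero
  constructor
  · rintro i hi hip ⟨a, b, hab⟩
    have hd : hasseDeriv i (X ^ (p + 1) - X ^ p : (ZMod p)[X]) =
        monomial (p + 1 - i) (((p + 1).choose i : ℕ) : ZMod p)
          - monomial (p - i) ((p.choose i : ℕ) : ZMod p) := by
      rw [← monomial_one_right_eq_X_pow, ← monomial_one_right_eq_X_pow, map_sub,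
        hasseDeriv_monomial, hasseDeriv_monomial, mul_one, mul_one]
    rw [hd] at hab
    rcases hip.lt_or_eq with h | rfl
    · have := congrArg (eval 0) hab
      have h1 : p + 1 - i ≠ 0 := by omega
      have h2 : p - i ≠ 0 := by omega
      simp [eval_monomial, h1, h2, hp0] at this
    · have := congrArg (eval 1) hab
      simp [eval_monomial] at this
  · rintro L _ f ⟨c, r, h⟩
    have h0 := congrArg (eval 0) h
    have h1 := congrArg (eval 1) h
    have hc := congrArg (fun q => coeff q (p + 1)) h
    have hc0 : c ≠ 0 := by
      rintro rfl
      simp [coeff_X_pow] at hc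
    simp [hp0, hc0] at h0
    simp [h0] at h1
    exact hc0 h1.symm
end

section
/- Over the field 𝔽_7 = ZMod 7, the polynomial P = X^2·(X − 1)·(X − 3) of degree 4 satisfies: for every integer i with 1 ≤ i ≤ 3, the polynomials P and its i-th Hasse derivative are not coprime (indeed P and P_1 vanish at 0, P_3 vanishes at the root 1 of P, and P_2 vanishes at the root 3 of P), yet there exist no c, r ∈ ZMod 7 with P = c·(X − r)^4. Hence 7 is a bad prime for the Casas-Alvero conjecture in degree 4. -/
open Polynomial

theorem bad_prime_7_deg4 :
    let P : (ZMod 7)[X] := X ^ 2 * (X - C 1) * (X - C 3)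
    P.degree = 4 ∧
    P.eval 0 = 0 ∧ (hasseDeriv 1 P).eval 0 = 0 ∧
    P.eval 1 = 0 ∧ (hasseDeriv 3 P).eval 1 = 0 ∧
    P.eval 3 = 0 ∧ (hasseDeriv 2 P).eval 3 = 0 ∧
    (∀ i : ℕ, 1 ≤ i → i ≤ 3 → ¬ IsCoprime P (hasseDeriv i P)) ∧
    ¬ ∃ c r : ZMod 7, P = C c * (X - C r) ^ 4 := by
  intro P
  have hP : P = monomial 4 1 + monomial 3 (-4) + monomial 2 3 := by
    simp only [← C_mul_X_pow_eq_monomial, P, C_neg, C_1]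
    have h4 : (C 4 : (ZMod 7)[X]) = C 1 + C 3 := by rw [← C_add]; congr 1
    rw [h4, C_1]; ring
  have key : ∀ a : ZMod 7, ∀ i, P.eval a = 0 → (hasseDeriv i P).eval a = 0 →
      ¬ IsCoprime P (hasseDeriv i P) := by
    rintro a i h1 h2 ⟨u, v, h⟩
    have := congrArg (eval a) h
    simp [h1, h2] at this
    exact absurd this (by decide)
  have e0 : P.eval 0 = 0 := by simp [P]
  have e1 : P.eval 1 = 0 := by simp [P]
  have e3 : P.eval 3 = 0 := by simp [P]
  have d1 : (hasseDeriv 1 P).eval 0 = 0 := by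
    rw [hP]; simp only [map_add, hasseDeriv_monomial, eval_add, eval_monomial]; decide
  have d3 : (hasseDeriv 3 P).eval 1 = 0 := by
    rw [hP]; simp only [map_add, hasseDeriv_monomial, eval_add, eval_monomial]; decide
  have d2 : (hasseDeriv 2 P).eval 3 = 0 := by
    rw [hP]; simp only [map_add, hasseDeriv_monomial, eval_add, eval_monomial]; decide
  refine ⟨?_, e0, d1, e1, d3, e3, d2, ?_, ?_⟩
  · have : Fact (Nat.Prime 7) := ⟨by norm_num⟩
    simp only [P, degree_mul, degree_X_pow, degree_X_sub_C]; rfl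
  · intro i h1 h3
    interval_cases i
    · exact key 0 1 e0 d1
    · exact key 3 2 e3 d2
    · exact key 1 3 e1 d3
  · rintro ⟨c, r, h⟩
    have f0 := congrArg (eval 0) h
    have f1 := congrArg (eval 1) h
    have f2 := congrArg (eval 2) h
    simp only [P, eval_mul, eval_pow, eval_sub, eval_X, eval_C] at f0 f1 f2
    clear h
    clear e0 e1 e3 d1 d2 d3 key hP P
    revert c r
    decide
end

section
/- Over the field 𝔽_5 = ZMod 5, the polynomial P = X^2·(X − 1)·(X + 1) = X^4 − X^2 of degree 4 satisfies: for every integer i with 1 ≤ i ≤ 3, the polynomials P and its i-th Hasse derivative are not coprime (indeed P, P_1 and P_3 all vanish at 0, and P_2 vanishes at the root 1 of P), yet there exist no c, r ∈ ZMod 5 with P = c·(X − r)^4. Hence 5 is a bad prime for the Casas-Alvero conjecture in degree 4 (correcting an omission in Draisma–de Jong). -/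
open Polynomial

theorem bad_prime_5_deg4 :
    let P : (ZMod 5)[X] := X ^ 2 * (X - C 1) * (X + C 1)
    P = X ^ 4 - X ^ 2 ∧
    P.degree = 4 ∧
    P.eval 0 = 0 ∧ (hasseDeriv 1 P).eval 0 = 0 ∧ (hasseDeriv 3 P).eval 0 = 0 ∧
    P.eval 1 = 0 ∧ (hasseDeriv 2 P).eval 1 = 0 ∧
    (∀ i : ℕ, 1 ≤ i → i ≤ 3 → ¬ IsCoprime P (hasseDeriv i P)) ∧
    ¬ ∃ c r : ZMod 5, P = C c * (X - C r) ^ 4 := by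
  intro P
  have hnt : Nontrivial (ZMod 5) := ⟨0, 1, by decide⟩
  have hP : P = X ^ 4 - X ^ 2 := by
    simp only [P, map_one]
    ring
  clear_value P
  subst hP
  have key : ∀ Q : (ZMod 5)[X], ∀ a : ZMod 5, (X ^ 4 - X ^ 2 : (ZMod 5)[X]).eval a = 0 →
      Q.eval a = 0 → ¬ IsCoprime (X ^ 4 - X ^ 2 : (ZMod 5)[X]) Q := by
    rintro Q a h1 h2 ⟨u, v, h⟩
    have := congrArg (eval a) h
    rw [eval_add, eval_mul, eval_mul, h1, h2] at this
    simp at this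
  have hd : ∀ i : ℕ, ∀ a : ZMod 5, (hasseDeriv i (X ^ 4 - X ^ 2 : (ZMod 5)[X])).eval a
      = (Nat.choose 4 i : ZMod 5) * a ^ (4 - i) - (Nat.choose 2 i : ZMod 5) * a ^ (2 - i) := by
    intro i a
    rw [map_sub, ← monomial_one_right_eq_X_pow, ← monomial_one_right_eq_X_pow,
      hasseDeriv_monomial, hasseDeriv_monomial]
    simp
  have e0 : (X ^ 4 - X ^ 2 : (ZMod 5)[X]).eval 0 = 0 := by simp
  have e1 : (X ^ 4 - X ^ 2 : (ZMod 5)[X]).eval 1 = 0 := by simp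
  have d1 : (hasseDeriv 1 (X ^ 4 - X ^ 2 : (ZMod 5)[X])).eval 0 = 0 := by rw [hd]; decide
  have d3 : (hasseDeriv 3 (X ^ 4 - X ^ 2 : (ZMod 5)[X])).eval 0 = 0 := by rw [hd]; decide
  have d2 : (hasseDeriv 2 (X ^ 4 - X ^ 2 : (ZMod 5)[X])).eval 1 = 0 := by rw [hd]; decide
  refine ⟨rfl, by compute_degree!, e0, d1, d3, e1, d2, ?_, ?_⟩
  · intro i h1 h3
    interval_cases i
    · exact key _ 0 e0 d1
    · exact key _ 1 e1 d2
    · exact key _ 0 e0 d3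
  · rintro ⟨c, r, h⟩
    have h0 := congrArg (eval 0) h
    have h1 := congrArg (eval 1) h
    have h2 := congrArg (eval 2) h
    simp only [eval_sub, eval_pow, eval_X, eval_mul, eval_C] at h0 h1 h2
    revert c r
    intro c r _ h0 h1 h2
    clear * - h0 h1 h2
    revert c r
    decide
end

section
/- Over the field 𝔽_8009 = ZMod 8009, the polynomial P = X^5 − 5X^4 − 3309X^3 + 3313X^2, which factors as X^2·(X − 1)·(X − r)·(X − (4 − r)) with r = 2113, satisfies: for every integer i with 1 ≤ i ≤ 4, the polynomials P and its i-th Hasse derivative are not coprime (indeed P and P_1 vanish at 0, P_4(1) = 0, P_3(r) = 0 and P_2(4 − r) = 0), yet there exist no c, s ∈ ZMod 8009 with P = c·(X − s)^5. Hence 8009 is a bad prime for the Casas-Alvero conjecture in degree 5. -/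
open Polynomial

theorem bad_prime_8009_deg5 :
    let r : ZMod 8009 := 2113
    let P : (ZMod 8009)[X] := X ^ 5 - 5 * X ^ 4 - 3309 * X ^ 3 + 3313 * X ^ 2
    P = X ^ 2 * (X - C 1) * (X - C r) * (X - C (4 - r)) ∧
    P.degree = 5 ∧
    P.eval 0 = 0 ∧ (hasseDeriv 1 P).eval 0 = 0 ∧
    (hasseDeriv 4 P).eval 1 = 0 ∧
    (hasseDeriv 3 P).eval r = 0 ∧
    (hasseDeriv 2 P).eval (4 - r) = 0 ∧
    (∀ i : ℕ, 1 ≤ i → i ≤ 4 → ¬ IsCoprime P (hasseDeriv i P)) ∧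
    ¬ ∃ c s : ZMod 8009, P = C c * (X - C s) ^ 5 := by
  intro r P
  have hP : P = monomial 5 1 - monomial 4 5 - monomial 3 3309 + monomial 2 3313 := by
    simp only [← C_mul_X_pow_eq_monomial, P, map_one, map_ofNat, one_mul]
  have he : ∀ x, P.eval x = x ^ 5 - 5 * x ^ 4 - 3309 * x ^ 3 + 3313 * x ^ 2 := by
    intro x
    simp [hP, eval_monomial]
  have h8 : (8009 : (ZMod 8009)[X]) = 0 := by
    have h : (8009 : ZMod 8009) = 0 := by decide
    rw [← map_ofNat (C : ZMod 8009 →+* _), h, map_zero]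
  have hr : r = 2113 := rfl
  have c51 : Nat.choose 5 1 = 5 := rfl
  have c52 : Nat.choose 5 2 = 10 := rfl
  have c53 : Nat.choose 5 3 = 10 := rfl
  have c54 : Nat.choose 5 4 = 5 := rfl
  have c42 : Nat.choose 4 2 = 6 := rfl
  have c43 : Nat.choose 4 3 = 4 := rfl
  have c32 : Nat.choose 3 2 = 3 := rfl
  have c34 : Nat.choose 3 4 = 0 := rfl
  have c23 : Nat.choose 2 3 = 0 := rfl
  have c24 : Nat.choose 2 4 = 0 := rfl
  have h1 : (hasseDeriv 1 P).eval 0 = 0 := by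
    rw [hP]; simp [hasseDeriv_monomial, eval_monomial]
  have h4 : (hasseDeriv 4 P).eval 1 = 0 := by
    rw [hP]; simp [hasseDeriv_monomial, eval_monomial, c54, c34, c24]
  have h3 : (hasseDeriv 3 P).eval r = 0 := by
    rw [hP]; simp only [hasseDeriv_monomial, eval_monomial, c53, c43, c23, map_add, map_sub, eval_add, eval_sub, hr, Nat.choose_self]
    decide
  have h2 : (hasseDeriv 2 P).eval (4 - r) = 0 := by
    rw [hP]; simp only [hasseDeriv_monomial, eval_monomial, c52, c42, c32, map_add, map_sub, eval_add, eval_sub, hr, Nat.choose_self]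
    decide
  have e0 : P.eval 0 = 0 := by simp [he]
  have e1 : P.eval 1 = 0 := by rw [he]; decide
  have er : P.eval r = 0 := by rw [he, hr]; decide
  have es : P.eval (4 - r) = 0 := by rw [he, hr]; decide
  have e2 : P.eval 2 ≠ 0 := by rw [he]; decide
  have : Fact (Nat.Prime 8009) := ⟨by norm_num⟩
  have key : ∀ (Q : (ZMod 8009)[X]) (x : ZMod 8009), P.eval x = 0 → Q.eval x = 0 →
      ¬ IsCoprime P Q := by
    rintro Q x hp hq ⟨a, b, hab⟩
    have := congrArg (eval x) hab
    simp [hp, hq] at this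
  refine ⟨?_, ?_, e0, h1, h4, h3, h2, ?_, ?_⟩
  · simp only [P, hr, map_sub, map_one, map_ofNat]
    linear_combination (556 * X ^ 3 - 556 * X ^ 2) * h8
  · simp only [P]
    have : (X ^ 5 - 5 * X ^ 4 - 3309 * X ^ 3 + 3313 * X ^ 2 : (ZMod 8009)[X]) =
      X ^ 5 - C 5 * X ^ 4 - C 3309 * X ^ 3 + C 3313 * X ^ 2 := by simp only [map_ofNat]
    rw [this]
    compute_degree!
  · intro i hi hi'
    interval_cases i
    · exact key _ _ e0 h1
    · exact key _ _ es h2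
    · exact key _ _ er h3
    · exact key _ _ e1 h4
  · rintro ⟨c, s, h⟩
    have hh : ∀ x, P.eval x = c * (x - s) ^ 5 := by
      intro x; rw [h]; simp
    have hc : c = 0 := by
      have a0 := hh 0
      have a1 := hh 1
      rw [e0] at a0
      rw [e1] at a1
      rcases mul_eq_zero.1 a0.symm with h | h
      · exact h
      rcases mul_eq_zero.1 a1.symm with h' | h'
      · exact h'
      have u := pow_eq_zero_iff (by norm_num) |>.1 h
      have v := pow_eq_zero_iff (by norm_num) |>.1 h'
      exact absurd (show (1 : ZMod 8009) = 0 by linear_combination v - u) one_ne_zero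
    exact e2 (by rw [hh, hc, zero_mul])
end

section
/- Over the field 𝔽_3541 = ZMod 3541, the polynomial P = X^5 − 10X^3 − 9X^2, which factors as X^2·(X + 1)·(X − 1567)·(X + 1566), satisfies: for every integer i with 1 ≤ i ≤ 4, the polynomials P and its i-th Hasse derivative are not coprime (indeed P, P_1 and P_4 vanish at 0, P_3(−1) = 0 with −1 a root of P, and P_2(1567) = 0 with 1567 a root of P), yet there exist no c, s ∈ ZMod 3541 with P = c·(X − s)^5. Hence 3541 is a bad prime for the Casas-Alvero conjecture in degree 5. -/
open Polynomial

theorem fact_prime_3541 : Fact (Nat.Prime 3541) := ⟨by norm_num⟩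

theorem bad_prime_3541_deg5 :
    let P : (ZMod 3541)[X] := X ^ 5 - 10 * X ^ 3 - 9 * X ^ 2
    P = X ^ 2 * (X + C 1) * (X - C 1567) * (X + C 1566) ∧
    P.degree = 5 ∧
    P.eval 0 = 0 ∧ (hasseDeriv 1 P).eval 0 = 0 ∧ (hasseDeriv 4 P).eval 0 = 0 ∧
    P.eval (-1) = 0 ∧ (hasseDeriv 3 P).eval (-1) = 0 ∧
    P.eval 1567 = 0 ∧ (hasseDeriv 2 P).eval 1567 = 0 ∧
    (∀ i : ℕ, 1 ≤ i → i ≤ 4 → ¬ IsCoprime P (hasseDeriv i P)) ∧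
    ¬ ∃ c s : ZMod 3541, P = C c * (X - C s) ^ 5 := by
  intro P
  have hm : P = monomial 5 1 - monomial 3 10 - monomial 2 9 := by
    simp only [P, ← C_mul_X_pow_eq_monomial]
    rw [show (10 : (ZMod 3541)[X]) = C 10 from rfl, show (9 : (ZMod 3541)[X]) = C 9 from rfl]
    simp only [C_1, one_mul]
  have hfac : P = X ^ 2 * (X + C 1) * (X - C 1567) * (X + C 1566) := by
    have h1 : (C (1567 * 1566 : ZMod 3541)) = C 9 := congrArg C (by decide)
    have h2 : (C (1567 : ZMod 3541)) = C 1566 + 1 := by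
      rw [← C_1, ← C_add]; exact congrArg C (by decide)
    have h9 : (C (9 : ZMod 3541)) = 9 := rfl
    rw [C_mul, h2, h9] at h1
    rw [h2, C_1]
    simp only [P]
    linear_combination (X ^ 3 + X ^ 2) * h1
  have hdeg : P.degree = 5 := by
    have := fact_prime_3541
    simp only [P]
    rw [show (10 : (ZMod 3541)[X]) = C 10 from rfl, show (9 : (ZMod 3541)[X]) = C 9 from rfl]
    compute_degree!
  have e0 : P.eval 0 = 0 := by simp [P]
  have e1 : (hasseDeriv 1 P).eval 0 = 0 := by
    rw [hm]; simp [hasseDeriv_monomial]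
  have e4 : (hasseDeriv 4 P).eval 0 = 0 := by
    rw [hm]; simp [hasseDeriv_monomial, Nat.choose]
  have em : P.eval (-1) = 0 := by
    rw [hm]; simp only [eval_sub, eval_monomial]; decide
  have e3 : (hasseDeriv 3 P).eval (-1) = 0 := by
    rw [hm]; simp only [map_sub, hasseDeriv_monomial, eval_sub, eval_monomial]; decide
  have eq : P.eval 1567 = 0 := by
    rw [hm]; simp only [eval_sub, eval_monomial]; decide
  have e2 : (hasseDeriv 2 P).eval 1567 = 0 := by
    rw [hm]; simp only [map_sub, hasseDeriv_monomial, eval_sub, eval_monomial]; decide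
  have key : ∀ (Q : (ZMod 3541)[X]) (a : ZMod 3541), P.eval a = 0 → Q.eval a = 0 →
      ¬ IsCoprime P Q := by
    have := fact_prime_3541
    rintro Q a h1 h2 ⟨u, v, h⟩
    have := congrArg (eval a) h
    simp [h1, h2] at this
  refine ⟨hfac, hdeg, e0, e1, e4, em, e3, eq, e2, ?_, ?_⟩
  · intro i h1 h4
    interval_cases i
    · exact key _ _ e0 e1
    · exact key _ _ eq e2
    · exact key _ _ em e3
    · exact key _ _ e0 e4
  · have := fact_prime_3541
    rintro ⟨c, s, h⟩
    have hc : c ≠ 0 := by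
      rintro rfl
      rw [h] at hdeg
      simp at hdeg
    rw [h] at e0 em
    simp [hc] at e0 em
    simp [e0] at em
end

section
/- Over the field 𝔽_599 = ZMod 599, the polynomial P = X^5 + 5X^4 − 4X^2, which factors as X^2·(X + 1)·(X + 269)·(X − 265), satisfies: for every integer i with 1 ≤ i ≤ 4, the polynomials P and its i-th Hasse derivative are not coprime (indeed P, P_1 and P_3 vanish at 0, P_4(−1) = 0 with −1 a root of P, and P_2(−269) = 0 with −269 a root of P), yet there exist no c, s ∈ ZMod 599 with P = c·(X − s)^5. Hence 599 is a bad prime for the Casas-Alvero conjecture in degree 5. -/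
open Polynomial

theorem P599_hd (k : ℕ) (a : ZMod 599) :
    (hasseDeriv k (X ^ 5 + 5 * X ^ 4 - 4 * X ^ 2 : (ZMod 599)[X])).eval a =
      (Nat.choose 5 k : ZMod 599) * a ^ (5 - k) + (Nat.choose 4 k : ZMod 599) * 5 * a ^ (4 - k)
        - (Nat.choose 2 k : ZMod 599) * 4 * a ^ (2 - k) := by
  have h : (X ^ 5 + 5 * X ^ 4 - 4 * X ^ 2 : (ZMod 599)[X]) =
      monomial 5 1 + monomial 4 5 - monomial 2 4 := by
    simp only [← C_mul_X_pow_eq_monomial, C_1, one_mul]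
    rfl
  rw [h]
  simp only [map_add, map_sub, hasseDeriv_monomial, eval_add, eval_sub, eval_monomial, mul_one]

theorem P599_nc (P Q : (ZMod 599)[X]) (a : ZMod 599) (h1 : P.eval a = 0) (h2 : Q.eval a = 0) :
    ¬ IsCoprime P Q := by
  rintro ⟨u, v, h⟩
  have := congrArg (eval a) h
  simp only [eval_add, eval_mul, h1, h2, mul_zero, add_zero, eval_one] at this
  exact absurd this (by decide +kernel)

theorem bad_prime_599_deg5 :
    let P : (ZMod 599)[X] := X ^ 5 + 5 * X ^ 4 - 4 * X ^ 2
    P = X ^ 2 * (X + C 1) * (X + C 269) * (X - C 265) ∧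
    P.degree = 5 ∧
    P.eval 0 = 0 ∧ (hasseDeriv 1 P).eval 0 = 0 ∧ (hasseDeriv 3 P).eval 0 = 0 ∧
    P.eval (-1) = 0 ∧ (hasseDeriv 4 P).eval (-1) = 0 ∧
    P.eval (-269) = 0 ∧ (hasseDeriv 2 P).eval (-269) = 0 ∧
    (∀ i : ℕ, 1 ≤ i → i ≤ 4 → ¬ IsCoprime P (hasseDeriv i P)) ∧
    ¬ ∃ c s : ZMod 599, P = C c * (X - C s) ^ 5 := by
  intro P
  have e (a : ZMod 599) : P.eval a = a ^ 5 + 5 * a ^ 4 - 4 * a ^ 2 := by simp [P]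
  have e0 : P.eval 0 = 0 := by rw [e]; decide +kernel
  have e1 : P.eval (-1) = 0 := by rw [e]; decide +kernel
  have e2 : P.eval (-269) = 0 := by rw [e]; decide +kernel
  have d1 : (hasseDeriv 1 P).eval 0 = 0 := by rw [P599_hd]; decide +kernel
  have d3 : (hasseDeriv 3 P).eval 0 = 0 := by rw [P599_hd]; decide +kernel
  have d4 : (hasseDeriv 4 P).eval (-1) = 0 := by rw [P599_hd]; decide +kernel
  have d2 : (hasseDeriv 2 P).eval (-269) = 0 := by rw [P599_hd]; decide +kernel
  have n2 : (1 : ZMod 599) ^ 5 + 5 * 1 ^ 4 - 4 * 1 ^ 2 ≠ 0 := by decide +kernel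
  have n3 : ((-1 : ZMod 599) - 0) ^ 5 ≠ 0 := by decide +kernel
  have : Fact (Nat.Prime 599) := ⟨by norm_num⟩
  refine ⟨?_, ?_, e0, d1, d3, e1, d4, e2, d2, ?_, ?_⟩
  · have h : (599 : (ZMod 599)[X]) = 0 := by
      have : ((599 : ℕ) : (ZMod 599)[X]) = 0 := CharP.cast_eq_zero _ 599
      exact_mod_cast this
    have c1 : (C 269 : (ZMod 599)[X]) = 269 := rfl
    have c2 : (C 265 : (ZMod 599)[X]) = 265 := rfl
    rw [c1, c2, C_1]
    simp only [P]
    linear_combination (119 * X ^ 2 * (X + 1)) * h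
  · simp only [P]
    have c1 : (5 : (ZMod 599)[X]) = C 5 := rfl
    have c2 : (4 : (ZMod 599)[X]) = C 4 := rfl
    rw [c1, c2]
    compute_degree!
  · intro i h1 h4
    interval_cases i
    · exact P599_nc _ _ _ e0 d1
    · exact P599_nc _ _ _ e2 d2
    · exact P599_nc _ _ _ e0 d3
    · exact P599_nc _ _ _ e1 d4
  · rintro ⟨c, s, h⟩
    have g (a : ZMod 599) : a ^ 5 + 5 * a ^ 4 - 4 * a ^ 2 = c * (a - s) ^ 5 := by
      rw [← e, h]; simp
    have g1 := g 1
    have g0 : c * (0 - s) ^ 5 = 0 := by rw [← g, ← e]; exact e0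
    rcases mul_eq_zero.1 g0 with hc | hs
    · rw [hc, zero_mul] at g1
      exact n2 g1
    · have hs : s = 0 := by simpa using hs
      have gm : c * (-1 - s) ^ 5 = 0 := by rw [← g, ← e]; exact e1
      have hc : c = 0 := by
        rw [hs] at gm
        rcases mul_eq_zero.1 gm with hc | hc
        · exact hc
        · exact absurd hc n3
      rw [hc, zero_mul] at g1
      exact n2 g1
end

section
/- Over the field 𝔽_7 = ZMod 7, the polynomial P = X^5 − 3X^4 + 2X^3, which factors as X^3·(X − 1)·(X − 2), satisfies: for every integer i with 1 ≤ i ≤ 4, the polynomials P and its i-th Hasse derivative are not coprime (indeed P, P_1 and P_2 vanish at 0, P_3(1) = 0 with 1 a root of P, and P_4(2) = 0 with 2 a root of P), yet there exist no c, s ∈ ZMod 7 with P = c·(X − s)^5. Hence 7 is a bad prime for the Casas-Alvero conjecture in degree 5. -/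
open Polynomial

theorem bad_prime_7_deg5_hasse (i : ℕ) (x : ZMod 7) :
    (hasseDeriv i (X ^ 5 - 3 * X ^ 4 + 2 * X ^ 3 : (ZMod 7)[X])).eval x =
      (Nat.choose 5 i : ZMod 7) * x ^ (5 - i) - (Nat.choose 4 i : ZMod 7) * 3 * x ^ (4 - i)
        + (Nat.choose 3 i : ZMod 7) * 2 * x ^ (3 - i) := by
  have h : (X ^ 5 - 3 * X ^ 4 + 2 * X ^ 3 : (ZMod 7)[X]) =
      monomial 5 1 - monomial 4 3 + monomial 3 2 := by
    simp only [← C_mul_X_pow_eq_monomial, map_ofNat, map_one, one_mul]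
  rw [h, map_add, map_sub, hasseDeriv_monomial, hasseDeriv_monomial, hasseDeriv_monomial]
  simp only [eval_add, eval_sub, eval_monomial, mul_one]

theorem bad_prime_7_deg5_cop (P Q : (ZMod 7)[X]) (x : ZMod 7) (hP : P.eval x = 0)
    (hQ : Q.eval x = 0) : ¬ IsCoprime P Q := by
  rintro ⟨a, b, h⟩
  have := congrArg (eval x) h
  rw [eval_add, eval_mul, eval_mul, hP, hQ, eval_one, mul_zero, mul_zero, add_zero] at this
  exact absurd this (by decide)

theorem bad_prime_7_deg5 :
    let P : (ZMod 7)[X] := X ^ 5 - 3 * X ^ 4 + 2 * X ^ 3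
    P = X ^ 3 * (X - C 1) * (X - C 2) ∧
    P.degree = 5 ∧
    P.eval 0 = 0 ∧ (hasseDeriv 1 P).eval 0 = 0 ∧ (hasseDeriv 2 P).eval 0 = 0 ∧
    P.eval 1 = 0 ∧ (hasseDeriv 3 P).eval 1 = 0 ∧
    P.eval 2 = 0 ∧ (hasseDeriv 4 P).eval 2 = 0 ∧
    (∀ i : ℕ, 1 ≤ i → i ≤ 4 → ¬ IsCoprime P (hasseDeriv i P)) ∧
    ¬ ∃ c s : ZMod 7, P = C c * (X - C s) ^ 5 := by
  intro P
  have hev : ∀ x, P.eval x = x ^ 5 - 3 * x ^ 4 + 2 * x ^ 3 := by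
    intro x; simp [P]
  have hf : P = X ^ 3 * (X - C 1) * (X - C 2) := by
    simp only [P, map_one, map_ofNat]; ring
  have e0 : P.eval 0 = 0 := by rw [hev]; decide
  have e1 : P.eval 1 = 0 := by rw [hev]; decide
  have e2 : P.eval 2 = 0 := by rw [hev]; decide
  have d1 : (hasseDeriv 1 P).eval 0 = 0 := by rw [bad_prime_7_deg5_hasse]; decide
  have d2 : (hasseDeriv 2 P).eval 0 = 0 := by rw [bad_prime_7_deg5_hasse]; decide
  have d3 : (hasseDeriv 3 P).eval 1 = 0 := by rw [bad_prime_7_deg5_hasse]; decide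
  have d4 : (hasseDeriv 4 P).eval 2 = 0 := by rw [bad_prime_7_deg5_hasse]; decide
  refine ⟨hf, ?_, e0, d1, d2, e1, d3, e2, d4, ?_, ?_⟩
  · haveI : Fact (Nat.Prime 7) := ⟨by norm_num⟩
    rw [hf, degree_mul, degree_mul, degree_X_pow, degree_X_sub_C, degree_X_sub_C]
    rfl
  · intro i h1 h4
    interval_cases i
    · exact bad_prime_7_deg5_cop _ _ 0 e0 d1
    · exact bad_prime_7_deg5_cop _ _ 0 e0 d2
    · exact bad_prime_7_deg5_cop _ _ 1 e1 d3
    · exact bad_prime_7_deg5_cop _ _ 2 e2 d4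
  · rintro ⟨c, s, h⟩
    have h' : ∀ x, x ^ 5 - 3 * x ^ 4 + 2 * x ^ 3 = c * (x - s) ^ 5 := by
      intro x; rw [← hev, h]; simp
    have k0 := h' 0
    have k1 := h' 1
    have k3 := h' 3
    clear h h'
    revert c s
    decide
end
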